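/- arXiv:0711.4426 — 6 statements merged into one kernel-verified Lean document; each statement's English description precedes it below -/
import Mathlib

section
/- Let n be a natural number with 2n > 8 (i.e., n ≥ 5), and let G be a hamiltonian bipartite graph on 2n vertices whose two colour classes each have n vertices and in which every vertex has degree exactly n/2 (so in particular n is even). Then G contains a cycle of length 2n − 2. -/
namespace SimpleGraph

variable {V : Type*} {G : SimpleGraph V}

/-- A sequence of consecutively adjacent vertices is the support of a walk. -/
theorem exists_walk_support_edges (w : ℕ → V) (m : ℕ)
    (hadj : ∀ t < m, G.Adj (w t) (w (t + 1))) :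
    ∃ p : G.Walk (w 0) (w m), p.support = (List.range (m + 1)).map w ∧
      p.edges = (List.range m).map (fun t => s(w t, w (t + 1))) ∧ p.length = m := by
  induction m with
  | zero => exact ⟨Walk.nil, by simp⟩
  | succ m ih =>
    obtain ⟨p, hs, he, hl⟩ := ih fun t ht => hadj t (by omega)
    refine ⟨p.concat (hadj m (by omega)), ?_, ?_, ?_⟩
    · rw [Walk.support_concat, hs, List.range_succ (n := m + 1)]
      simp
    · rw [Walk.edges_concat, he, List.range_succ]
      simp
    · rw [Walk.length_concat, hl]

/-- An injective cyclic sequence of consecutively adjacent vertices gives a cycle. -/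
theorem exists_isCycle_of_injOn (w : ℕ → V) (m : ℕ) (hm : 2 ≤ m)
    (hinj : ∀ s ≤ m, ∀ t ≤ m, w s = w t → s = t)
    (hadj : ∀ t < m, G.Adj (w t) (w (t + 1))) (hclose : G.Adj (w m) (w 0)) :
    ∃ (v : V) (c : G.Walk v v), c.IsCycle ∧ c.length = m + 1 := by
  obtain ⟨p, hs, he, hl⟩ := exists_walk_support_edges w m hadj
  refine ⟨w m, Walk.cons hclose p, (Walk.cons_isCycle_iff p hclose).2 ⟨?_, ?_⟩, ?_⟩
  · apply Walk.IsPath.mk'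
    rw [hs]
    refine List.Nodup.map_on ?_ List.nodup_range
    intro s h1 t h2 h
    rw [List.mem_range] at h1 h2
    exact hinj s (by omega) t (by omega) h
  · rw [he]
    intro h
    obtain ⟨t, ht, h⟩ := List.mem_map.1 h
    rw [List.mem_range] at ht
    rw [Sym2.eq_iff] at h
    rcases h with ⟨h, -⟩ | ⟨h, h'⟩
    · have := hinj _ (by omega) _ le_rfl h
      omega
    · have h1 := hinj _ (by omega) _ (by omega) h
      have h2 := hinj _ (by omega) _ (by omega) h'
      omega
  · rw [Walk.length_cons, hl]

/-- `u` runs periodically around a Hamilton cycle with `N` vertices. -/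
structure IsHamiltonSeq (G : SimpleGraph V) (N : ℕ) (u : ℕ → V) : Prop where
  periodic : ∀ i, u (i + N) = u i
  inj : ∀ i j, u i = u j → i % N = j % N
  surj : ∀ v, ∃ i, u i = v
  adj : ∀ i, G.Adj (u i) (u (i + 1))

theorem exists_isHamiltonSeq [Fintype V] [DecidableEq V] (h : G.IsHamiltonian)
    (hV : Fintype.card V ≠ 1) : ∃ u, IsHamiltonSeq G (Fintype.card V) u := by
  obtain ⟨a, p, hp⟩ := h hV
  have hlen := hp.length_eq
  have hcyc := hp.isCycle
  have h3 := hcyc.three_le_length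
  rw [← hlen]
  refine ⟨fun i => p.getVert (i % p.length), ⟨?_, ?_, ?_, ?_⟩⟩
  · intro i
    simp
  · intro i j h
    have hi := Nat.mod_lt i (show 0 < p.length by omega)
    have hj := Nat.mod_lt j (show 0 < p.length by omega)
    exact hcyc.getVert_injOn' (by simp only [Set.mem_ofPred_eq]; omega)
      (by simp only [Set.mem_ofPred_eq]; omega) h
  · intro v
    obtain ⟨t, ht, hle⟩ := Walk.mem_support_iff_exists_getVert.1 (hp.mem_support v)
    rcases hle.lt_or_eq with h | h
    · exact ⟨t, by simp only [Nat.mod_eq_of_lt h, ht]⟩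
    · refine ⟨0, ?_⟩
      rw [← ht, h]
      simp
  · intro i
    have hi := Nat.mod_lt i (show 0 < p.length by omega)
    have key := p.adj_getVert_succ hi
    by_cases h : i % p.length + 1 = p.length
    · have h' : (i + 1) % p.length = 0 := by
        rw [Nat.add_mod, Nat.mod_eq_of_lt (show 1 < p.length by omega), h, Nat.mod_self]
      rw [h, Walk.getVert_length] at key
      simpa [h'] using key
    · have h' : (i + 1) % p.length = i % p.length + 1 := by
        rw [Nat.add_mod, Nat.mod_eq_of_lt (show 1 < p.length by omega), Nat.mod_eq_of_lt]
        omega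
      simpa [h'] using key

namespace IsHamiltonSeq

variable {N : ℕ} {u : ℕ → V}

theorem inj_window (hu : IsHamiltonSeq G N u) {i a b : ℕ} (ha : 0 < a) (ha' : a ≤ N)
    (hb : 0 < b) (hb' : b ≤ N) (h : u (i + a) = u (i + b)) : a = b := by
  have h1 : a ≡ b [MOD N] := Nat.ModEq.add_left_cancel' i (hu.inj _ _ h)
  have h2 : (a - 1) + 1 ≡ (b - 1) + 1 [MOD N] := by
    rwa [Nat.sub_add_cancel ha, Nat.sub_add_cancel hb]
  have := (Nat.ModEq.add_right_cancel' 1 h2).eq_of_lt_of_lt (by omega) (by omega)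
  omega

theorem adj_of_eq (hu : IsHamiltonSeq G N u) {a b : ℕ} (h : b = a + 1) :
    G.Adj (u a) (u b) := h ▸ hu.adj a

theorem adj_of_eq' (hu : IsHamiltonSeq G N u) {a b : ℕ} (h : a = b + 1) :
    G.Adj (u a) (u b) := (hu.adj_of_eq h).symm

/-- A rearrangement of `N - 2` of the positions along the Hamilton cycle, consecutively
adjacent, gives a cycle of length `N - 2`. -/
theorem exists_isCycle (hu : IsHamiltonSeq G N u) (hN : 5 ≤ N) (i : ℕ) (g : ℕ → ℕ)
    (hpos : ∀ t < N - 2, 0 < g t ∧ g t ≤ N)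
    (hinj : ∀ s < N - 2, ∀ t < N - 2, g s = g t → s = t)
    (hadj : ∀ t < N - 3, G.Adj (u (i + g t)) (u (i + g (t + 1))))
    (hclose : G.Adj (u (i + g (N - 3))) (u (i + g 0))) :
    ∃ (v : V) (c : G.Walk v v), c.IsCycle ∧ c.length = N - 2 := by
  have := exists_isCycle_of_injOn (fun t => u (i + g t)) (N - 3) (by omega) ?_ hadj hclose
  · rwa [show N - 3 + 1 = N - 2 by omega] at this
  · intro s hs t ht h
    have h1 := hpos s (by omega)
    have h2 := hpos t (by omega)
    exact hinj s (by omega) t (by omega) (hu.inj_window h1.1 h1.2 h2.1 h2.2 h)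

/-- A chord between two vertices at distance three. -/
theorem exists_isCycle_of_adj_three (hu : IsHamiltonSeq G N u) (hN : 5 ≤ N) (i : ℕ)
    (h : G.Adj (u i) (u (i + 3))) :
    ∃ (v : V) (c : G.Walk v v), c.IsCycle ∧ c.length = N - 2 := by
  refine hu.exists_isCycle hN i (fun t => t + 3) ?_ ?_ ?_ ?_
  · intro t ht
    omega
  · intro s _ t _ h
    omega
  · intro t _
    exact hu.adj_of_eq (by omega)
  · rw [show i + (N - 3 + 3) = i + N by omega, hu.periodic]
    exact h

/-- Two crossing chords whose ends are at distances three and one. -/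
theorem exists_isCycle_of_adj_of_adj_three_one (hu : IsHamiltonSeq G N u) (hN : 5 ≤ N)
    (i d : ℕ) (hd : 3 ≤ d) (hd' : d < N) (h : G.Adj (u i) (u (i + d)))
    (hpar : G.Adj (u (i + 3)) (u (i + d + 1))) :
    ∃ (v : V) (c : G.Walk v v), c.IsCycle ∧ c.length = N - 2 := by
  refine hu.exists_isCycle hN i (fun t => if t ≤ d - 3 then t + 3 else N + d - 2 - t) ?_ ?_ ?_ ?_
  · intro t ht
    split_ifs <;> omega
  · intro s _ t _ h
    split_ifs at h <;> omega
  · intro t ht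
    split_ifs with h1 h2 h2
    · exact hu.adj_of_eq (by omega)
    · rw [show i + (t + 3) = i + d by omega, show i + (N + d - 2 - (t + 1)) = i + N by omega,
        hu.periodic]
      exact h.symm
    · omega
    · exact hu.adj_of_eq' (by omega)
  · rw [if_neg (by omega), if_pos (by omega),
      show i + (N + d - 2 - (N - 3)) = i + d + 1 by omega]
    exact hpar.symm

/-- Two crossing chords both of whose ends are at distance two. -/
theorem exists_isCycle_of_adj_of_adj_two_two (hu : IsHamiltonSeq G N u) (hN : 5 ≤ N)
    (i d : ℕ) (hd : 2 ≤ d) (hd' : d + 2 ≤ N) (h : G.Adj (u i) (u (i + d)))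
    (hpar : G.Adj (u (i + 2)) (u (i + 2 + d))) :
    ∃ (v : V) (c : G.Walk v v), c.IsCycle ∧ c.length = N - 2 := by
  refine hu.exists_isCycle hN i (fun t => if t ≤ d - 2 then t + 2 else N + d - 1 - t) ?_ ?_ ?_ ?_
  · intro t ht
    split_ifs <;> omega
  · intro s _ t _ h
    split_ifs at h <;> omega
  · intro t ht
    split_ifs with h1 h2 h2
    · exact hu.adj_of_eq (by omega)
    · rw [show i + (t + 2) = i + d by omega, show i + (N + d - 1 - (t + 1)) = i + N by omega,
        hu.periodic]
      exact h.symm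
    · omega
    · exact hu.adj_of_eq' (by omega)
  · rw [if_neg (by omega), if_pos (by omega),
      show i + (N + d - 1 - (N - 3)) = i + 2 + d by omega]
    exact hpar.symm

/-- Three chords spanning at most nine consecutive steps of the Hamilton cycle. -/
theorem exists_isCycle_of_three_chords (hu : IsHamiltonSeq G N u) (hN : 16 ≤ N) (i : ℕ)
    (h₁ : G.Adj (u (i + 7)) (u (i + 12))) (h₂ : G.Adj (u (i + 10)) (u (i + 15)))
    (h₃ : G.Adj (u (i + 9)) (u (i + 16))) :
    ∃ (v : V) (c : G.Walk v v), c.IsCycle ∧ c.length = N - 2 := by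
  refine hu.exists_isCycle (by omega) i (fun t => if t ≤ 6 then t + 1 else if t ≤ 10 then t + 5
    else if t = 11 then 10 else if t = 12 then 9 else t + 3) ?_ ?_ ?_ ?_
  · intro t ht
    split_ifs <;> omega
  · intro s _ t _ h
    split_ifs at h <;> omega
  · intro t ht
    rcases (by omega : t = 6 ∨ t = 10 ∨ t = 12 ∨ t = 11 ∨ t < 6 ∨ (6 < t ∧ t < 10) ∨ 12 < t) with
      rfl | rfl | rfl | rfl | h | h | h
    · simpa using h₁
    · simpa using h₂.symm
    · simpa using h₃
    · exact hu.adj_of_eq' (by simp)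
    all_goals
      refine hu.adj_of_eq ?_
      split_ifs <;> omega
  · rw [if_neg (by omega), if_neg (by omega), if_neg (by omega), if_neg (by omega),
      if_pos (by omega), show i + (N - 3 + 3) = i + N by omega, hu.periodic]
    exact hu.adj i

/-- The degree of a vertex counted along the Hamilton cycle. -/
theorem card_filter_adj [Fintype V] [DecidableRel G.Adj] (hu : IsHamiltonSeq G N u)
    (hN : 0 < N) (i : ℕ) :
    ((Finset.range N).filter fun d => G.Adj (u i) (u (i + d))).card = G.degree (u i) := by
  rw [← G.card_neighborFinset_eq_degree]
  refine Finset.card_bij (fun d _ => u (i + d)) ?_ ?_ ?_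
  · intro d hd
    simpa using (Finset.mem_filter.1 hd).2
  · intro a ha b hb h
    have ha := Finset.mem_range.1 (Finset.mem_filter.1 ha).1
    have hb := Finset.mem_range.1 (Finset.mem_filter.1 hb).1
    exact (Nat.ModEq.add_left_cancel' i (hu.inj _ _ h)).eq_of_lt_of_lt ha hb
  · intro v hv
    obtain ⟨j, rfl⟩ := hu.surj v
    have hper : ∀ a q, u (a + N * q) = u a := by
      intro a q
      induction q with
      | zero => simp
      | succ q ih => rw [Nat.mul_succ, ← Nat.add_assoc, hu.periodic, ih]
    have key : u (i + (j + (N - 1) * i) % N) = u j := by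
      have h1 := Nat.mod_add_div (j + (N - 1) * i) N
      rw [← hper _ ((j + (N - 1) * i) / N), Nat.add_assoc, h1, ← hper j i]
      congr 1
      obtain ⟨M, rfl⟩ := Nat.exists_eq_add_of_lt hN
      simp only [Nat.zero_add, Nat.add_sub_cancel]
      ring
    refine ⟨(j + (N - 1) * i) % N, ?_, key⟩
    rw [Finset.mem_filter, key]
    exact ⟨Finset.mem_range.2 (Nat.mod_lt _ hN), by simpa using hv⟩

/-- In a bipartite graph, chords join positions of opposite parity. -/
theorem odd_of_adj (hu : IsHamiltonSeq G N u) (C : G.Coloring Bool) {i d : ℕ}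
    (h : G.Adj (u i) (u (i + d))) : d % 2 = 1 := by
  have hflip : ∀ j, C (u (j + 1)) = !C (u j) := fun j => by
    have := C.valid (hu.adj j)
    revert this
    cases C (u j) <;> cases C (u (j + 1)) <;> simp
  have hshift : ∀ e, C (u (i + 2 * e)) = C (u i) := by
    intro e
    induction e with
    | zero => simp
    | succ e ih =>
      rw [show i + 2 * (e + 1) = i + 2 * e + 1 + 1 by ring, hflip, hflip, ih, Bool.not_not]
  by_contra hd
  have h1 := hshift (d / 2)
  rw [show 2 * (d / 2) = d by omega] at h1
  exact C.valid h h1.symm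

/-- If there is no cycle of length `N - 2`, then of two chords which differ by a shift by two,
at least one is an edge. -/
theorem adj_or_adj_shift_two [Fintype V] [DecidableRel G.Adj] {k : ℕ}
    (hu : IsHamiltonSeq G (4 * k) u) (hk : 3 ≤ k) (C : G.Coloring Bool)
    (hreg : ∀ v, G.degree v = k)
    (hno : ¬ ∃ (v : V) (c : G.Walk v v), c.IsCycle ∧ c.length = 4 * k - 2)
    (i d : ℕ) (hd : 5 ≤ d) (hd' : d + 5 ≤ 4 * k) (hodd : d % 2 = 1) :
    G.Adj (u i) (u (i + d)) ∨ G.Adj (u (i + 2)) (u (i + 2 + d)) := by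
  by_contra! hcon
  set D : ℕ → Finset ℕ := fun i => (Finset.range (4 * k)).filter fun d => G.Adj (u i) (u (i + d))
    with hD
  have hcard : ∀ i, (D i).card = k := fun i => by
    rw [hD, hu.card_filter_adj (by omega), hreg]
  have hinter : D i ∩ D (i + 2) ⊆ {1, 4 * k - 1} := by
    intro e he
    simp only [hD, Finset.mem_inter, Finset.mem_filter, Finset.mem_range] at he
    have h1 := hu.odd_of_adj C he.1.2
    simp only [Finset.mem_insert, Finset.mem_singleton]
    by_contra h
    exact hno (hu.exists_isCycle_of_adj_of_adj_two_two (by omega) i e (by omega) (by omega)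
      he.1.2 he.2.2)
  have hsub : ∀ j, ¬ G.Adj (u j) (u (j + d)) →
      D j ⊆ ((((Finset.range (2 * k)).image (2 * · + 1)).erase 3).erase (4 * k - 3)).erase d := by
    intro j hj e he
    simp only [hD, Finset.mem_filter, Finset.mem_range] at he
    have h1 := hu.odd_of_adj C he.2
    simp only [Finset.mem_erase, Finset.mem_image, Finset.mem_range]
    refine ⟨?_, ?_, ?_, e / 2, by omega, by omega⟩
    · rintro rfl
      exact hj he.2
    · rintro rfl
      refine hno (hu.exists_isCycle_of_adj_three (by omega) (j + (4 * k - 3)) ?_)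
      rw [show j + (4 * k - 3) + 3 = j + 4 * k by omega, hu.periodic]
      exact he.2.symm
    · rintro rfl
      exact hno (hu.exists_isCycle_of_adj_three (by omega) j he.2)
  have hunion := Finset.card_le_card (Finset.union_subset (hsub i hcon.1) (hsub (i + 2) hcon.2))
  rw [Finset.card_erase_of_mem, Finset.card_erase_of_mem, Finset.card_erase_of_mem,
    Finset.card_image_of_injective _ (fun a b h => by omega),
    Finset.card_range] at hunion
  · have h1 := Finset.card_le_card hinter
    have h2 := Finset.card_le_two (a := 1) (b := 4 * k - 1)
    have h3 := Finset.card_union_add_card_inter (D i) (D (i + 2))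
    rw [hcard, hcard] at h3
    omega
  · simp only [Finset.mem_image, Finset.mem_range]
    exact ⟨1, by omega, rfl⟩
  · simp only [Finset.mem_erase, Finset.mem_image, Finset.mem_range]
    exact ⟨by omega, 2 * k - 2, by omega, by omega⟩
  · simp only [Finset.mem_erase, Finset.mem_image, Finset.mem_range]
    exact ⟨by omega, by omega, d / 2, by omega, by omega⟩

/-- A `k`-regular bipartite graph with a Hamilton cycle on `4 * k ≥ 12` vertices has a cycle
missing exactly two vertices. -/
theorem exists_isCycle_of_regular [Fintype V] [DecidableRel G.Adj] {k : ℕ}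
    (hu : IsHamiltonSeq G (4 * k) u) (hk : 3 ≤ k) (C : G.Coloring Bool)
    (hreg : ∀ v, G.degree v = k) :
    ∃ (v : V) (c : G.Walk v v), c.IsCycle ∧ c.length = 4 * k - 2 := by
  by_contra hno
  have hor := hu.adj_or_adj_shift_two hk C hreg hno
  have hnand : ∀ i, ¬ (G.Adj (u i) (u (i + 5)) ∧ G.Adj (u (i + 2)) (u (i + 2 + 5))) :=
    fun i h => hno (hu.exists_isCycle_of_adj_of_adj_two_two (by omega) i 5 (by omega) (by omega)
      h.1 h.2)
  have hcross : ∀ i, ¬ (G.Adj (u i) (u (i + 7)) ∧ G.Adj (u (i + 3)) (u (i + 3 + 5))) :=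
    fun i h => hno (hu.exists_isCycle_of_adj_of_adj_three_one (by omega) i 7 (by omega) (by omega)
      h.1 h.2)
  have hflip : ∀ i, G.Adj (u (i + 2)) (u (i + 2 + 5)) ↔ ¬ G.Adj (u i) (u (i + 5)) := fun i => by
    have h1 := hor i 5 (by omega) (by omega) (by omega)
    have h2 := hnand i
    tauto
  by_cases hk3 : k = 3
  · subst hk3
    have hfalse : ∀ i, ¬ G.Adj (u (i + 3)) (u (i + 3 + 5)) := fun i h => by
      refine hcross i ⟨?_, h⟩
      have h1 := hflip (i + 3)
      have h2 := (hflip (i + 5)).2 (by tauto)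
      rw [show i + 5 + 2 + 5 = i + 4 * 3 by omega, hu.periodic] at h2
      exact h2.symm
    exact hfalse 2 ((hflip 3).2 (hfalse 0))
  · obtain ⟨i, h1, h2⟩ : ∃ i, G.Adj (u (i + 7)) (u (i + 7 + 5)) ∧
        G.Adj (u (i + 10)) (u (i + 10 + 5)) := by
      by_contra! h
      have a0 := h 0
      have a1 := h 1
      have a2 := h 2
      have a3 := h 3
      have f7 := hflip 7
      have f8 := hflip 8
      have f9 := hflip 9
      have f10 := hflip 10
      have f11 := hflip 11
      norm_num at *
      tauto
    refine hno (hu.exists_isCycle_of_three_chords (by omega) i h1 h2 ?_)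
    rcases hor (i + 7) 7 (by omega) (by omega) (by omega) with h | h
    · exact absurd ⟨h, h2⟩ (hcross (i + 7))
    · exact h

end IsHamiltonSeq

end SimpleGraph


/-- A hamiltonian `n/2`-regular balanced bipartite graph of order `2n > 8` contains a
cycle of length `2n - 2`.  (The regularity hypothesis is stated as `2 * degree v = n`,
which says precisely that every vertex has degree `n / 2` and that `n` is even.) -/
theorem hamiltonian_regular_bipartite_cycle_2n_sub_2
    (n : ℕ) (hn : 2 * n > 8)
    (G : SimpleGraph (Fin n ⊕ Fin n)) [DecidableRel G.Adj]
    (hbip : ∀ i j : Fin n, ¬ G.Adj (Sum.inl i) (Sum.inl j) ∧ ¬ G.Adj (Sum.inr i) (Sum.inr j))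
    (hreg : ∀ v : Fin n ⊕ Fin n, 2 * G.degree v = n)
    (hham : G.IsHamiltonian) :
    ∃ (v : Fin n ⊕ Fin n) (c : G.Walk v v), c.IsCycle ∧ c.length = 2 * n - 2 := by
  obtain ⟨k, rfl⟩ : ∃ k, n = 2 * k := ⟨G.degree (Sum.inl ⟨0, by omega⟩), (hreg _).symm⟩
  obtain ⟨u, hu⟩ := SimpleGraph.exists_isHamiltonSeq hham (by simp; omega)
  rw [show Fintype.card (Fin (2 * k) ⊕ Fin (2 * k)) = 4 * k by simp; omega] at hu
  have C : G.Coloring Bool := SimpleGraph.Coloring.mk Sum.isLeft (by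
    rintro (i | i) (j | j) h
    · exact absurd h (hbip i j).1
    · simp
    · simp
    · exact absurd h (hbip i j).2)
  rw [show 2 * (2 * k) - 2 = 4 * k - 2 by omega]
  exact hu.exists_isCycle_of_regular (by omega) C fun v => by
    have := hreg v
    omega
end

section
/- Let n be a natural number with 2n > 8 (i.e., n ≥ 5), and let G be a hamiltonian bipartite graph on 2n vertices whose two colour classes each have n vertices and in which every vertex has degree exactly n/2. If G contains a cycle C of length 2n − 2 such that the two vertices of G not lying on C are adjacent in G, then G is bipancyclic, i.e., G contains a cycle of length ℓ for every even ℓ with 4 ≤ ℓ ≤ 2n. -/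
namespace SimpleGraph

open Finset

variable {V : Type*} {G : SimpleGraph V}

/-- `G` contains a cycle of length `ℓ`. -/
def HasCycleOfLength (G : SimpleGraph V) (ℓ : ℕ) : Prop :=
  ∃ (w : V) (c : G.Walk w w), c.IsCycle ∧ c.length = ℓ

/-- A sequence of distinct, consecutively adjacent vertices traces a path. -/
lemma exists_isPath_of_injective_seq (p : ℕ → V) (L : ℕ)
    (hinj : ∀ i j, i < j → j ≤ L → p i ≠ p j)
    (hadj : ∀ i < L, G.Adj (p i) (p (i + 1))) :
    ∃ q : G.Walk (p 0) (p L), q.IsPath ∧ q.length = L ∧ ∀ v ∈ q.support, ∃ i ≤ L, v = p i := by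
  induction L with
  | zero => exact ⟨Walk.nil, by simp, by simp, by simp⟩
  | succ L ih =>
    obtain ⟨q, hq, hql, hqs⟩ := ih (fun i j hij hj => hinj i j hij (by omega))
      (fun i hi => hadj i (by omega))
    refine ⟨q.concat (hadj L (by omega)), ?_, by simp [hql], ?_⟩
    · refine hq.concat (fun hmem => ?_) _
      obtain ⟨i, hi, he⟩ := hqs _ hmem
      exact hinj i (L + 1) (by omega) le_rfl he.symm
    · intro v hv
      rw [Walk.support_concat, List.mem_append, List.mem_singleton] at hv
      rcases hv with hv | rfl
      · obtain ⟨i, hi, he⟩ := hqs v hv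
        exact ⟨i, by omega, he⟩
      · exact ⟨L + 1, le_rfl, rfl⟩

/-- A closed sequence of `L + 1 ≥ 3` distinct, consecutively adjacent vertices is a cycle. -/
lemma hasCycleOfLength_of_injective_seq (p : ℕ → V) (L : ℕ) (hL : 2 ≤ L)
    (hinj : ∀ i j, i < j → j ≤ L → p i ≠ p j)
    (hadj : ∀ i < L, G.Adj (p i) (p (i + 1))) (hclose : G.Adj (p L) (p 0)) :
    G.HasCycleOfLength (L + 1) := by
  obtain ⟨q, hq, hql, -⟩ := exists_isPath_of_injective_seq p L hinj hadj
  refine ⟨_, Walk.cons hclose q, (Walk.cons_isCycle_iff _ _).2 ⟨hq, fun hmem => ?_⟩, by simp [hql]⟩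
  rw [Sym2.eq_swap] at hmem
  have := hq.length_eq_one_of_mem_edges hmem
  omega

section CyclicOrder

variable {N : ℕ} {c : ZMod N → V}

lemma natCast_add_left_injOn (t : ZMod N) {i j : ℕ} (hi : i < N) (hj : j < N)
    (h : t + (i : ZMod N) = t + (j : ZMod N)) : i = j := by
  have := add_left_cancel h
  rwa [ZMod.natCast_eq_natCast_iff', Nat.mod_eq_of_lt hi, Nat.mod_eq_of_lt hj] at this

/-- Cycles of `G` whose vertices all lie on the given cycle `c`, described by positions on `c`. -/
lemma hasCycleOfLength_of_positions (hc : Function.Injective c)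
    (hadj : ∀ u, G.Adj (c u) (c (u + 1))) (t : ZMod N) (q : ℕ → ℕ) (L : ℕ) (hL : 2 ≤ L)
    (hlt : ∀ i ≤ L, q i < N) (hinj : ∀ i j, i < j → j ≤ L → q i ≠ q j)
    (hstep : ∀ i < L, q (i + 1) = q i + 1 ∨ q i = q (i + 1) + 1 ∨
      G.Adj (c (t + (q i : ZMod N))) (c (t + (q (i + 1) : ZMod N))))
    (hclose : G.Adj (c (t + (q L : ZMod N))) (c (t + (q 0 : ZMod N)))) :
    G.HasCycleOfLength (L + 1) := by
  refine hasCycleOfLength_of_injective_seq (fun i => c (t + (q i : ZMod N))) L hL ?_ ?_ hclose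
  · intro i j hij hj he
    exact hinj i j hij hj (natCast_add_left_injOn t (hlt i (by omega)) (hlt j hj) (hc he))
  · intro i hi
    rcases hstep i hi with h | h | h
    · have := hadj (t + (q i : ZMod N))
      simpa [h, add_assoc] using this
    · have := (hadj (t + (q (i + 1) : ZMod N))).symm
      simpa [h, add_assoc] using this
    · exact h

/-- Two chords `{0, D}` and `{a, w}` with `a < D ≤ w`, joined by the arcs `[0, a]` and `[D, w]`. -/
lemma hasCycleOfLength_of_chords_short (hc : Function.Injective c)
    (hadj : ∀ u, G.Adj (c u) (c (u + 1))) (t : ZMod N) {h a D w : ℕ} (hh : 1 ≤ h)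
    (haD : a < D) (hDw : D ≤ w) (hw : w < N) (hlen : a + w = 2 * h + D)
    (h₁ : G.Adj (c t) (c (t + (D : ZMod N))))
    (h₂ : G.Adj (c (t + (a : ZMod N))) (c (t + (w : ZMod N)))) :
    G.HasCycleOfLength (2 * h + 2) := by
  refine hasCycleOfLength_of_positions hc hadj t
    (fun i => if i ≤ a then i else w + a + 1 - i) (2 * h + 1) (by omega) ?_ ?_ ?_ ?_
  · intro i hi
    split_ifs <;> omega
  · intro i j hij hj
    split_ifs <;> omega
  · intro i hi
    by_cases hia : i = a
    · subst hia
      right; right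
      have : w + i + 1 - (i + 1) = w := by omega
      simpa [this] using h₂
    · split_ifs <;> omega
  · have e : w + a + 1 - (2 * h + 1) = D := by omega
    have e' : ¬ 2 * h + 1 ≤ a := by omega
    simpa [e, e'] using h₁.symm

/-- Two chords `{0, D}` and `{a, w}` with `0 < a ≤ D < w`, joined by the arcs `[a, D]` and
`[w, N]`. -/
lemma hasCycleOfLength_of_chords_long (hc : Function.Injective c)
    (hadj : ∀ u, G.Adj (c u) (c (u + 1))) (t : ZMod N) {h a D w : ℕ} (hh : 1 ≤ h)
    (ha : 1 ≤ a) (haD : a ≤ D) (hDw : D < w) (hw : w < N) (hlen : D + N = 2 * h + a + w)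
    (h₁ : G.Adj (c t) (c (t + (D : ZMod N))))
    (h₂ : G.Adj (c (t + (a : ZMod N))) (c (t + (w : ZMod N)))) :
    G.HasCycleOfLength (2 * h + 2) := by
  refine hasCycleOfLength_of_positions hc hadj t
    (fun i => if i = 0 then 0 else if i ≤ D - a + 1 then D + 1 - i else i + w + a - D - 2)
    (2 * h + 1) (by omega) ?_ ?_ ?_ ?_
  · intro i hi
    split_ifs <;> omega
  · intro i j hij hj
    split_ifs <;> omega
  · intro i hi
    by_cases hi0 : i = 0
    · subst hi0
      right; right
      simpa using h₁
    by_cases hia : i = D - a + 1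
    · subst hia
      right; right
      have e₁ : D + 1 - (D - a + 1) = a := by omega
      have e₂ : D - a + 1 + 1 + w + a - D - 2 = w := by omega
      simpa [e₁, e₂] using h₂
    · split_ifs <;> first | omega | (left; omega)
  · have e : 2 * h + 1 + w + a - D - 2 = N - 1 := by omega
    have e' : ¬ 2 * h + 1 ≤ D - a + 1 := by omega
    have e₂ : ((N - 1 : ℕ) : ZMod N) + 1 = 0 := by
      rw [← Nat.cast_succ, Nat.succ_eq_add_one, Nat.sub_add_cancel (by omega)]
      simp
    have := hadj (t + ((N - 1 : ℕ) : ZMod N))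
    rw [add_assoc, e₂] at this
    simpa [e, e'] using this

open Classical in
/-- The number of chords of the cycle `c` that span `D` steps (counted from their tails). -/
noncomputable def chordCount (G : SimpleGraph V) [NeZero N] (c : ZMod N → V) (D : ℕ) : ℕ :=
  #{t : ZMod N | G.Adj (c t) (c (t + (D : ZMod N)))}

variable [NeZero N]

open Classical in
lemma card_filter_chord_shift (a D w : ℕ) (h : a + D = w) :
    #{t : ZMod N | G.Adj (c (t + (a : ZMod N))) (c (t + (w : ZMod N)))} = chordCount G c D := by
  subst h
  refine Finset.card_bij' (fun t _ => t + a) (fun t _ => t - a) ?_ ?_ ?_ ?_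
  · simp [add_assoc]
  · simp [← add_assoc]
  · simp
  · simp

lemma chordCount_add_le {a D D' w : ℕ} (haw : a + D' = w)
    (hconf : ∀ t : ZMod N, G.Adj (c t) (c (t + (D : ZMod N))) →
      ¬ G.Adj (c (t + (a : ZMod N))) (c (t + (w : ZMod N)))) :
    chordCount G c D + chordCount G c D' ≤ N := by
  classical
  rw [← card_filter_chord_shift a D' w haw, chordCount, ← Finset.card_union_of_disjoint]
  · exact (Finset.card_le_univ _).trans (ZMod.card N).le
  · rw [Finset.disjoint_filter]
    exact fun t _ => hconf t

lemma chordCount_add_le_of_short (hc : Function.Injective c)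
    (hadj : ∀ u, G.Adj (c u) (c (u + 1))) {h a D D' w : ℕ} (hh : 1 ≤ h)
    (hno : ¬ G.HasCycleOfLength (2 * h + 2)) (haw : a + D' = w)
    (haD : a < D) (hDw : D ≤ w) (hw : w < N) (hlen : a + w = 2 * h + D) :
    chordCount G c D + chordCount G c D' ≤ N :=
  chordCount_add_le haw fun t h₁ h₂ =>
    hno (hasCycleOfLength_of_chords_short hc hadj t hh haD hDw hw hlen h₁ h₂)

lemma chordCount_add_le_of_long (hc : Function.Injective c)
    (hadj : ∀ u, G.Adj (c u) (c (u + 1))) {h a D D' w : ℕ} (hh : 1 ≤ h)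
    (hno : ¬ G.HasCycleOfLength (2 * h + 2)) (haw : a + D' = w)
    (ha : 1 ≤ a) (haD : a ≤ D) (hDw : D < w) (hw : w < N) (hlen : D + N = 2 * h + a + w) :
    chordCount G c D + chordCount G c D' ≤ N :=
  chordCount_add_le haw fun t h₁ h₂ =>
    hno (hasCycleOfLength_of_chords_long hc hadj t hh ha haD hDw hw hlen h₁ h₂)

lemma chordCount_sub {D : ℕ} (hD : D ≤ N) : chordCount G c (N - D) = chordCount G c D := by
  classical
  rw [← card_filter_chord_shift D (N - D) N (by omega), chordCount]
  simp [G.adj_comm]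

end CyclicOrder

/-- If `S` is symmetric under `D ↦ 2m - D` and the odd arguments can be matched by reflecting
`[0, K]`, then the values of `S` at odd arguments below `2m` average at most `m`. -/
lemma sum_odd_le_sq (S : ℕ → ℕ) {m K : ℕ} (hK : K < m) (hKe : Even K)
    (hsymm : ∀ D ≤ 2 * m, S (2 * m - D) = S D)
    (hrefl : ∀ D, 1 ≤ D → D < K → S D + S (K - D) ≤ 2 * m)
    (hmid : ∀ D, K ≤ D → D + K ≤ 2 * m → S D + S D ≤ 2 * m) :
    ∑ D ∈ (range (2 * m)).filter Odd, S D ≤ m * m := by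
  let ι : ℕ → ℕ := fun D =>
    if D < K then K - D else if 2 * m < D + K then 4 * m - K - D else D
  have hι : ∀ D ∈ (range (2 * m)).filter Odd, ι D ∈ (range (2 * m)).filter Odd := by
    intro D hD
    simp only [mem_filter, mem_range, Nat.odd_iff, Nat.even_iff] at *
    simp only [ι]
    split_ifs <;> omega
  have hιι : ∀ D ∈ (range (2 * m)).filter Odd, ι (ι D) = D := by
    intro D hD
    simp only [mem_filter, mem_range, Nat.odd_iff, Nat.even_iff] at *
    simp only [ι]
    split_ifs <;> omega
  have hsum : ∑ D ∈ (range (2 * m)).filter Odd, S D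
      = ∑ D ∈ (range (2 * m)).filter Odd, S (ι D) :=
    Finset.sum_nbij' ι ι hι hι hιι hιι (fun D hD => by rw [hιι D hD])
  have hpair : ∀ D ∈ (range (2 * m)).filter Odd, S D + S (ι D) ≤ 2 * m := by
    intro D hD
    simp only [mem_filter, mem_range, Nat.odd_iff, Nat.even_iff] at *
    simp only [ι]
    split_ifs with h₁ h₂
    · exact hrefl D (by omega) h₁
    · have e₁ := hsymm D (by omega)
      have e₂ := hsymm (4 * m - K - D) (by omega)
      have e₃ := hrefl (2 * m - D) (by omega) (by omega)
      have e₄ : 2 * m - (4 * m - K - D) = K - (2 * m - D) := by omega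
      rw [e₄] at e₂
      omega
    · exact hmid D (by omega) (by omega)
  have hcard : #((range (2 * m)).filter Odd) = m := by
    have : (range (2 * m)).filter Odd = (range m).image (fun i => 2 * i + 1) := by
      ext D
      simp only [mem_filter, mem_range, mem_image, Nat.odd_iff]
      exact ⟨fun hD => ⟨D / 2, by omega, by omega⟩, by rintro ⟨i, hi, rfl⟩; omega⟩
    rw [this, Finset.card_image_of_injective _ (fun i j hij => by omega),
      card_range]
  have := Finset.sum_le_card_nsmul _ _ _ hpair
  rw [Finset.sum_add_distrib, ← hsum, hcard, smul_eq_mul] at this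
  nlinarith

/-- A graph with a cycle through `2m` vertices that has no cycle of length `2h + 2` has few odd
chords, unless `m = 2h + 1`. -/
lemma sum_chordCount_le {m : ℕ} [NeZero (2 * m)] {c : ZMod (2 * m) → V}
    (hc : Function.Injective c) (hadj : ∀ u, G.Adj (c u) (c (u + 1))) {h : ℕ} (hh : 1 ≤ h)
    (hm : h < m) (hodd : Odd m) (hne : m ≠ 2 * h + 1)
    (hno : ¬ G.HasCycleOfLength (2 * h + 2)) :
    ∑ D ∈ (range (2 * m)).filter Odd, chordCount G c D ≤ m * m := by
  rw [Nat.odd_iff] at hodd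
  rcases lt_or_ge (2 * h + 1) m with hlt | hge
  · refine sum_odd_le_sq _ (K := 2 * h + 2) (by omega) (by simp [parity_simps])
      (fun D hD => chordCount_sub hD) ?_ ?_
    · intro D h1 hD
      exact chordCount_add_le_of_short hc hadj hh hno (a := D - 1) (w := 2 * h + 1)
        (by omega) (by omega) (by omega) (by omega) (by omega)
    · intro D h1 hD
      exact chordCount_add_le_of_short hc hadj hh hno (a := h) (w := h + D)
        (by omega) (by omega) (by omega) (by omega) (by omega)
  · refine sum_odd_le_sq _ (K := 2 * m - 2 * h) (by omega) ⟨m - h, by omega⟩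
      (fun D hD => chordCount_sub hD) ?_ ?_
    · intro D h1 hD
      exact chordCount_add_le_of_long hc hadj hh hno (a := D) (w := 2 * m - 2 * h)
        (by omega) (by omega) (by omega) (by omega) (by omega) (by omega)
    · intro D h1 hD
      exact chordCount_add_le_of_long hc hadj hh hno (a := m - h) (w := m - h + D)
        (by omega) (by omega) (by omega) (by omega) (by omega) (by omega)

section ExceptionalLength

/-- If `A ± s` avoids `B` inside a set with `#A + #B + 1` elements, then `A` is almost invariant
under translation by `-2s`. -/
lemma eq_of_sub_sub_notMem {R : Type*} [AddCommGroup R] [DecidableEq R] {T A B : Finset R} {s : R}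
    {h : ℕ} (hT : #T = 2 * h + 1) (hA : #A = h) (hB : #B = h) (hBT : B ⊆ T)
    (hadd : ∀ a ∈ A, a + s ∈ T ∧ a + s ∉ B) (hsub : ∀ a ∈ A, a - s ∈ T ∧ a - s ∉ B) {a b : R}
    (ha : a ∈ A) (hb : b ∈ A) (ha' : a - s - s ∉ A) (hb' : b - s - s ∉ A) : a = b := by
  by_contra hne
  have hd₁ : Disjoint B (A.image (· + s)) := by
    rw [Finset.disjoint_right]
    intro z hz
    obtain ⟨w, hw, rfl⟩ := mem_image.1 hz
    exact (hadd w hw).2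
  have hd₂ : Disjoint (B ∪ A.image (· + s)) {a - s, b - s} := by
    rw [Finset.disjoint_right]
    intro z hz hz'
    rw [mem_insert, mem_singleton] at hz
    rcases mem_union.1 hz' with hzB | hzA
    · rcases hz with rfl | rfl
      · exact (hsub a ha).2 hzB
      · exact (hsub b hb).2 hzB
    · obtain ⟨w, hw, hwz⟩ := mem_image.1 hzA
      have hwz' : w = z - s := by rw [← hwz]; simp
      rcases hz with rfl | rfl
      · exact ha' (hwz' ▸ hw)
      · exact hb' (hwz' ▸ hw)
  have hsubset : (B ∪ A.image (· + s)) ∪ {a - s, b - s} ⊆ T := by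
    intro z hz
    simp only [mem_union, mem_image, mem_insert, mem_singleton] at hz
    rcases hz with (hz | ⟨w, hw, rfl⟩) | rfl | rfl
    · exact hBT hz
    · exact (hadd w hw).1
    · exact (hsub a ha).1
    · exact (hsub b hb).1
  have := card_le_card hsubset
  rw [card_union_of_disjoint hd₂, card_union_of_disjoint hd₁,
    card_image_of_injective _ (add_left_injective s),
    card_pair (fun e => hne (sub_left_injective e))] at this
  omega

lemma lt_card_of_walk {N : ℕ} {A : Finset (ZMod N)} {z : ZMod N} (hz : z ∈ A) {L : ℕ}
    (hL : 2 * L < N)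
    (hstep : ∀ j < L, z + ((2 * j : ℕ) : ZMod N) ∈ A → z + ((2 * (j + 1) : ℕ) : ZMod N) ∈ A) :
    L < #A := by
  have hmem : ∀ j ≤ L, z + ((2 * j : ℕ) : ZMod N) ∈ A := by
    intro j
    induction j with
    | zero => simpa using hz
    | succ j ih => exact fun hj => hstep j (by omega) (ih (by omega))
  have := Finset.card_le_card_of_injOn (s := range (L + 1)) (t := A)
    (fun j => z + ((2 * j : ℕ) : ZMod N)) (fun j hj => hmem j (by simp at hj; omega))
    (fun i hi j hj e => by
      simp only [coe_range, Set.mem_Iio] at hi hj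
      have := natCast_add_left_injOn z (i := 2 * i) (j := 2 * j) (by omega) (by omega) e
      omega)
  simpa using this

lemma false_of_almost_invariant {h : ℕ} (hh : 2 ≤ h) {A : Finset (ZMod (4 * h + 2))} (hA : #A = h)
    (huniq₂ : ∀ a ∈ A, ∀ b ∈ A, a + 2 ∉ A → b + 2 ∉ A → a = b)
    (huniq₄ : ∀ a ∈ A, ∀ b ∈ A, a + 4 ∉ A → b + 4 ∉ A → a = b) : False := by
  have cast_succ (z : ZMod (4 * h + 2)) (j : ℕ) :
      z + ((2 * (j + 1) : ℕ) : ZMod (4 * h + 2)) = z + ((2 * j : ℕ) : ZMod (4 * h + 2)) + 2 := by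
    push_cast; ring
  have hstuck : ∀ z ∈ A, ∃ j < h, z + ((2 * j : ℕ) : ZMod (4 * h + 2)) ∈ A ∧
      z + ((2 * j : ℕ) : ZMod (4 * h + 2)) + 2 ∉ A := by
    intro z hz
    by_contra! hcon
    have := lt_card_of_walk hz (L := h) (by omega)
      (fun j hj hmem => by rw [cast_succ]; exact hcon j hj hmem)
    omega
  obtain ⟨z, hz⟩ : A.Nonempty := card_pos.1 (by omega)
  obtain ⟨j, -, ha, ha2⟩ := hstuck z hz
  set a := z + ((2 * j : ℕ) : ZMod (4 * h + 2))
  obtain ⟨b, hb, hba⟩ := Finset.exists_mem_ne (by omega : 1 < #A) a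
  have hpred : a - 2 ∈ A := by
    by_contra hpred
    have hwalk : ∀ j : ℕ, b + ((2 * j : ℕ) : ZMod (4 * h + 2)) ∈ A ∧
        b + ((2 * j : ℕ) : ZMod (4 * h + 2)) ≠ a := by
      intro j
      induction j with
      | zero => simpa using ⟨hb, hba⟩
      | succ j ih =>
        rw [cast_succ]
        refine ⟨?_, fun he => hpred ?_⟩
        · by_contra hmem
          exact ih.2 (huniq₂ _ ih.1 _ ha hmem ha2)
        · rw [← he, add_sub_cancel_right]
          exact ih.1
    have := lt_card_of_walk hb (L := h) (by omega) (fun j _ _ => (hwalk (j + 1)).1)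
    omega
  have h4 : a + 4 ∈ A := by
    by_contra h4
    have e : a - 2 + 4 = a + 2 := by ring
    have := huniq₄ _ hpred _ ha (by rwa [e]) h4
    have h2 : a + ((2 : ℕ) : ZMod (4 * h + 2)) = a + ((0 : ℕ) : ZMod (4 * h + 2)) := by
      push_cast
      linear_combination -this
    have := natCast_add_left_injOn a (by omega) (by omega) h2
    omega
  obtain ⟨j, hjh, hj, hj2⟩ := hstuck _ h4
  have he := huniq₂ _ hj _ ha hj2 ha2
  have h2 : a + ((4 + 2 * j : ℕ) : ZMod (4 * h + 2)) = a + ((0 : ℕ) : ZMod (4 * h + 2)) := by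
    push_cast at he ⊢
    linear_combination he
  have := natCast_add_left_injOn a (by omega) (by omega) h2
  omega

end ExceptionalLength

section TwoVerticesOffCycle

variable {N : ℕ} {c : ZMod N → V}

/-- The arc of length `2h - 1` closed up through two adjacent vertices off the cycle `c`. -/
lemma hasCycleOfLength_of_arc_of_edge (hc : Function.Injective c)
    (hadj : ∀ u, G.Adj (c u) (c (u + 1))) {x y : V} (hx : ∀ u, c u ≠ x) (hy : ∀ u, c u ≠ y)
    (hxy : G.Adj x y) (t : ZMod N) {h : ℕ} (hh : 1 ≤ h) (hN : 2 * h ≤ N)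
    (h₁ : G.Adj y (c t)) (h₂ : G.Adj x (c (t + ((2 * h - 1 : ℕ) : ZMod N)))) :
    G.HasCycleOfLength (2 * h + 2) := by
  refine hasCycleOfLength_of_injective_seq
    (fun i => if i ≤ 2 * h - 1 then c (t + (i : ZMod N)) else if i = 2 * h then x else y)
    (2 * h + 1) (by omega) ?_ ?_ ?_
  · intro i j hij hj
    split_ifs
    any_goals omega
    · intro he
      have := natCast_add_left_injOn t (by omega) (by omega) (hc he)
      omega
    · exact hx _
    · exact hy _
    · exact hxy.ne
  · intro i hi
    split_ifs
    any_goals omega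
    · have := hadj (t + (i : ZMod N))
      simpa [add_assoc] using this
    · obtain rfl : i = 2 * h - 1 := by omega
      exact h₂.symm
  · have e : ¬ 2 * h + 1 ≤ 2 * h - 1 := by omega
    simpa [e] using h₁

/-- The arc of length `2h` closed up through a vertex off the cycle `c`. -/
lemma hasCycleOfLength_of_arc_of_vertex (hc : Function.Injective c)
    (hadj : ∀ u, G.Adj (c u) (c (u + 1))) {y : V} (hy : ∀ u, c u ≠ y)
    (t : ZMod N) {h : ℕ} (hh : 1 ≤ h) (hN : 2 * h < N)
    (h₁ : G.Adj y (c t)) (h₂ : G.Adj y (c (t + ((2 * h : ℕ) : ZMod N)))) :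
    G.HasCycleOfLength (2 * h + 2) := by
  refine hasCycleOfLength_of_injective_seq
    (fun i => if i ≤ 2 * h then c (t + (i : ZMod N)) else y) (2 * h + 1) (by omega) ?_ ?_ ?_
  · intro i j hij hj
    split_ifs
    any_goals omega
    · intro he
      have := natCast_add_left_injOn t (by omega) (by omega) (hc he)
      omega
    · exact hy _
  · intro i hi
    split_ifs
    any_goals omega
    · have := hadj (t + (i : ZMod N))
      simpa [add_assoc] using this
    · obtain rfl : i = 2 * h := by omega
      exact h₂.symm
  · simpa using h₁

variable {col : V → Bool}

lemma color_cycle_add (hcol : ∀ u v, G.Adj u v → col u ≠ col v)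
    (hadj : ∀ u, G.Adj (c u) (c (u + 1))) (z : ZMod N) (D : ℕ) :
    col (c (z + (D : ZMod N))) = if Even D then col (c z) else !col (c z) := by
  induction D with
  | zero => simp
  | succ D ih =>
    have := hcol _ _ (hadj (z + (D : ZMod N)))
    rw [ih] at this
    have e : z + ((D + 1 : ℕ) : ZMod N) = z + (D : ZMod N) + 1 := by push_cast; ring
    rw [e]
    by_cases hD : Even D
    · simp only [hD, if_true, Nat.even_add_one, not_true_eq_false, if_false] at this ⊢
      exact (Bool.eq_not_of_ne this.symm)
    · simp only [hD, if_false, Nat.even_add_one, not_false_eq_true, if_true] at this ⊢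
      simpa using Bool.eq_not_of_ne this.symm

lemma card_color_class_cycle [NeZero N] (hcol : ∀ u v, G.Adj u v → col u ≠ col v)
    (hadj : ∀ u, G.Adj (c u) (c (u + 1))) (b : Bool) :
    2 * #{z : ZMod N | col (c z) = b} = N := by
  have h₁ : #{z : ZMod N | col (c z) = b} = #{z : ZMod N | ¬ col (c z) = b} := by
    refine Finset.card_bij' (fun z _ => z + 1) (fun z _ => z - 1) ?_ ?_ ?_ ?_
    · intro z hz
      have := hcol _ _ (hadj z)
      simp only [mem_filter, mem_univ, true_and] at hz ⊢
      rw [hz] at this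
      exact this.symm
    · intro z hz
      have := hcol _ _ (hadj (z - 1))
      simp only [mem_filter, mem_univ, true_and, sub_add_cancel] at hz this ⊢
      revert hz this
      cases b <;> cases col (c z) <;> cases col (c (z - 1)) <;> simp
    · simp
    · simp
  have h₂ := Finset.card_filter_add_card_filter_not (s := (univ : Finset (ZMod N)))
    (fun z => col (c z) = b)
  rw [card_univ, ZMod.card] at h₂
  omega

open Classical in
/-- The length `2h + 2` on a cycle of length `4h + 2`. -/
lemma hasCycleOfLength_half (hcol : ∀ u v, G.Adj u v → col u ≠ col v) {h : ℕ} (hh : 2 ≤ h)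
    {c : ZMod (4 * h + 2) → V} (hc : Function.Injective c)
    (hadj : ∀ u, G.Adj (c u) (c (u + 1))) {x y : V} (hx : ∀ u, c u ≠ x) (hy : ∀ u, c u ≠ y)
    (hxy : G.Adj x y) (hxc : #{z | G.Adj x (c z)} = h) (hyc : #{z | G.Adj y (c z)} = h) :
    G.HasCycleOfLength (2 * h + 2) := by
  by_contra hno
  have hcolxy := hcol _ _ hxy
  have hcolx : ∀ z, G.Adj x (c z) → col (c z) = col y := by
    intro z hz
    have := hcol _ _ hz
    revert this hcolxy
    cases col (c z) <;> cases col x <;> cases col y <;> simp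
  have hcoly : ∀ z, G.Adj y (c z) → col (c z) = col x := by
    intro z hz
    have := hcol _ _ hz
    revert this hcolxy
    cases col (c z) <;> cases col x <;> cases col y <;> simp
  have hcard : ∀ b, #{z : ZMod (4 * h + 2) | col (c z) = b} = 2 * h + 1 := by
    intro b
    have := card_color_class_cycle hcol hadj b
    omega
  have hodd : ∀ z, col (c (z + ((2 * h - 1 : ℕ) : ZMod (4 * h + 2)))) = !col (c z) := by
    intro z
    rw [color_cycle_add hcol hadj, if_neg]
    rw [Nat.not_even_iff]
    omega
  have heven : ∀ z, col (c (z + ((2 * h : ℕ) : ZMod (4 * h + 2)))) = col (c z) := by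
    intro z
    rw [color_cycle_add hcol hadj, if_pos (by simp)]
  have hN : (4 * h + 2 : ZMod (4 * h + 2)) = 0 := by
    exact_mod_cast ZMod.natCast_self (4 * h + 2)
  refine false_of_almost_invariant hh hyc ?_ ?_
  · intro a ha b hb ha' hb'
    have hkey : ∀ z : ZMod (4 * h + 2),
        z - ((2 * h : ℕ) : ZMod (4 * h + 2)) - ((2 * h : ℕ) : ZMod (4 * h + 2)) = z + 2 := by
      intro z
      push_cast
      linear_combination -hN
    refine eq_of_sub_sub_notMem (hcard (col x)) hyc hyc ?_ ?_ ?_ ha hb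
      (by rwa [hkey]) (by rwa [hkey])
    · intro z hz
      simp only [mem_filter, mem_univ, true_and] at hz ⊢
      exact hcoly z hz
    · intro z hz
      simp only [mem_filter, mem_univ, true_and] at hz ⊢
      exact ⟨by rw [heven, hcoly z hz], fun hz' =>
        hno (hasCycleOfLength_of_arc_of_vertex hc hadj hy z (by omega) (by omega) hz hz')⟩
    · intro z hz
      simp only [mem_filter, mem_univ, true_and] at hz ⊢
      have := heven (z - ((2 * h : ℕ) : ZMod (4 * h + 2)))
      rw [sub_add_cancel] at this
      exact ⟨by rw [← this, hcoly z hz], fun hz' =>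
        hno (hasCycleOfLength_of_arc_of_vertex hc hadj hy _ (by omega) (by omega) hz'
          (by rwa [sub_add_cancel]))⟩
  · intro a ha b hb ha' hb'
    have hkey : ∀ z : ZMod (4 * h + 2),
        z - ((2 * h - 1 : ℕ) : ZMod (4 * h + 2)) - ((2 * h - 1 : ℕ) : ZMod (4 * h + 2))
          = z + 4 := by
      intro z
      rw [Nat.cast_sub (by omega)]
      push_cast
      linear_combination -hN
    have hcolxy' : (!col x) = col y := by
      revert hcolxy
      cases col x <;> cases col y <;> simp
    refine eq_of_sub_sub_notMem (hcard (col y)) hyc hxc ?_ ?_ ?_ ha hb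
      (by rwa [hkey]) (by rwa [hkey])
    · intro z hz
      simp only [mem_filter, mem_univ, true_and] at hz ⊢
      exact hcolx z hz
    · intro z hz
      simp only [mem_filter, mem_univ, true_and] at hz ⊢
      exact ⟨by rw [hodd, hcoly z hz, hcolxy'], fun hz' =>
        hno (hasCycleOfLength_of_arc_of_edge hc hadj hx hy hxy z (by omega) (by omega) hz hz')⟩
    · intro z hz
      simp only [mem_filter, mem_univ, true_and] at hz ⊢
      have := hodd (z - ((2 * h - 1 : ℕ) : ZMod (4 * h + 2)))
      rw [sub_add_cancel, hcoly z hz] at this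
      exact ⟨by rw [← hcolxy', this, Bool.not_not], fun hz' =>
        hno (hasCycleOfLength_of_arc_of_edge hc hadj hy hx hxy.symm _ (by omega) (by omega) hz'
          (by rwa [sub_add_cancel]))⟩

variable [NeZero N]

open Classical in
/-- Counting vertices on a cycle that misses exactly two vertices. -/
lemma card_filter_eq_on_cycle_add [Fintype V] (hc : Function.Injective c) {x y : V}
    (hx : ∀ u, c u ≠ x) (hy : ∀ u, c u ≠ y) (hxy : x ≠ y) (hV : Fintype.card V = N + 2)
    (P : V → Prop) :
    #{v | P v} = #{z | P (c z)} + (if P x then 1 else 0) + (if P y then 1 else 0) := by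
  have hx' : x ∉ univ.image c := by simpa using hx
  have hy' : y ∉ univ.image c := by simpa using hy
  have huniv : (univ : Finset V) = insert x (insert y (univ.image c)) := by
    refine (Finset.eq_univ_of_card _ ?_).symm
    rw [card_insert_of_notMem (by simp [hxy, hx]), card_insert_of_notMem hy',
      card_image_of_injective _ hc, card_univ, ZMod.card, hV]
  simp only [Finset.card_filter]
  rw [huniv, sum_insert (by simp [hxy, hx]), sum_insert hy', sum_image (fun a _ b _ e => hc e)]
  ring

open Classical in
lemma sum_card_adj_eq_sum_chordCount (hcol : ∀ u v, G.Adj u v → col u ≠ col v)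
    (hadj : ∀ u, G.Adj (c u) (c (u + 1))) :
    ∑ z, #{z' | G.Adj (c z) (c z')} = ∑ D ∈ (range N).filter Odd, chordCount G c D := by
  have h₁ : ∀ z, #{z' | G.Adj (c z) (c z')}
      = ∑ D ∈ range N, if G.Adj (c z) (c (z + (D : ZMod N))) then 1 else 0 := by
    intro z
    rw [Finset.card_filter]
    refine Finset.sum_nbij' (fun z' => (z' - z).val) (fun D => z + (D : ZMod N)) ?_ ?_ ?_ ?_ ?_
    · exact fun z' _ => mem_range.2 (ZMod.val_lt _)
    · simp
    · simp
    · intro D hD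
      simpa using Nat.mod_eq_of_lt (mem_range.1 hD)
    · simp
  rw [Finset.sum_congr rfl fun z _ => h₁ z, Finset.sum_comm, Finset.sum_filter]
  refine Finset.sum_congr rfl fun D _ => ?_
  rw [← Finset.card_filter]
  split_ifs with hD
  · rfl
  · rw [Finset.card_eq_zero, Finset.filter_eq_empty_iff]
    intro z _ hz
    apply hcol _ _ hz
    rw [color_cycle_add hcol hadj, if_pos (Nat.not_odd_iff_even.1 hD)]

open Classical in
/-- A `k`-regular bipartite graph of order `4k` with a cycle missing exactly two adjacent vertices
has cycles of all even lengths shorter than that cycle. -/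
lemma hasCycleOfLength_of_regular [Fintype V] (hcol : ∀ u v, G.Adj u v → col u ≠ col v)
    {m k h : ℕ}
    (hk : 3 ≤ k) (hm : m + 1 = 2 * k) [NeZero (2 * m)] (hV : Fintype.card V = 2 * m + 2)
    (hreg : ∀ v, #{w | G.Adj v w} = k) {c : ZMod (2 * m) → V} (hc : Function.Injective c)
    (hadj : ∀ u, G.Adj (c u) (c (u + 1))) {x y : V} (hx : ∀ u, c u ≠ x) (hy : ∀ u, c u ≠ y)
    (hxy : G.Adj x y) (hh : 1 ≤ h) (hhm : h < m) : G.HasCycleOfLength (2 * h + 2) := by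
  have hxc : #{z | G.Adj x (c z)} + 1 = k := by
    have := card_filter_eq_on_cycle_add hc hx hy hxy.ne hV (G.Adj x)
    rw [hreg x, if_neg (G.loopless.irrefl x), if_pos hxy] at this
    omega
  have hyc : #{z | G.Adj y (c z)} + 1 = k := by
    have := card_filter_eq_on_cycle_add hc hx hy hxy.ne hV (G.Adj y)
    rw [hreg y, if_neg (G.loopless.irrefl y), if_pos hxy.symm] at this
    omega
  by_cases hne : m = 2 * h + 1
  · obtain rfl : k = h + 1 := by omega
    subst hne
    have e : 2 * (2 * h + 1) = 4 * h + 2 := by ring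
    revert c
    rw! [e]
    intro c hc hadj hx hy hxc hyc
    exact hasCycleOfLength_half hcol (by omega) hc hadj hx hy hxy (by omega) (by omega)
  · by_contra hno
    have hle := sum_chordCount_le hc hadj hh hhm (Nat.odd_iff.2 (by omega)) hne hno
    rw [← sum_card_adj_eq_sum_chordCount hcol hadj] at hle
    have hsum : ∑ z : ZMod (2 * m), k = ∑ z, #{z' | G.Adj (c z) (c z')}
        + #{z | G.Adj x (c z)} + #{z | G.Adj y (c z)} := by
      rw [Finset.card_filter, Finset.card_filter, ← Finset.sum_add_distrib,
        ← Finset.sum_add_distrib]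
      refine Finset.sum_congr rfl fun z _ => ?_
      rw [← hreg (c z), card_filter_eq_on_cycle_add hc hx hy hxy.ne hV (G.Adj (c z)),
        G.adj_comm x, G.adj_comm y]
    rw [sum_const, card_univ, ZMod.card, smul_eq_mul] at hsum
    obtain ⟨k, rfl⟩ : ∃ j, k = j + 1 := ⟨k - 1, by omega⟩
    obtain rfl : m = 2 * k + 1 := by omega
    nlinarith

end TwoVerticesOffCycle

/-- A parametrisation of a cycle by `ZMod` of its length. -/
lemma Walk.IsCycle.exists_zmod_parametrisation {N : ℕ} [NeZero N] {v : V} {C : G.Walk v v}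
    (hC : C.IsCycle) (hlen : C.length = N) :
    ∃ c : ZMod N → V, Function.Injective c ∧ (∀ u, G.Adj (c u) (c (u + 1))) ∧
      ∀ u, c u ∈ C.support := by
  refine ⟨fun u => C.getVert u.val, ?_, ?_, fun u => C.getVert_mem_support _⟩
  · intro a b hab
    have ha := ZMod.val_lt a
    have hb := ZMod.val_lt b
    exact ZMod.val_injective N (hC.getVert_injOn' (by simp; omega) (by simp; omega) hab)
  · intro u
    have hu := ZMod.val_lt u
    have h3 := hC.three_le_length
    have h := C.adj_getVert_succ (i := u.val) (by omega)
    have : (u + 1).val = (u.val + 1) % N := by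
      rw [ZMod.val_add, ZMod.val_one'' (by omega)]
    dsimp only
    rw [this]
    rcases (by omega : u.val + 1 < N ∨ u.val + 1 = N) with hlt | heq
    · rwa [Nat.mod_eq_of_lt hlt]
    · have hend : C.getVert (u.val + 1) = v := by rw [heq, ← hlen, Walk.getVert_length]
      rw [hend] at h
      rwa [heq, Nat.mod_self, Walk.getVert_zero]

end SimpleGraph

/-- If a hamiltonian `n/2`-regular balanced bipartite graph of order `2n > 8` contains a
cycle `C` of length `2n - 2` such that the two vertices not lying on `C` are adjacent,
then `G` is bipancyclic. -/
theorem hamiltonian_regular_bipartite_bipancyclic_of_cycle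
    (n : ℕ) (hn : 2 * n > 8)
    (G : SimpleGraph (Fin n ⊕ Fin n)) [DecidableRel G.Adj]
    (hbip : ∀ i j : Fin n, ¬ G.Adj (Sum.inl i) (Sum.inl j) ∧ ¬ G.Adj (Sum.inr i) (Sum.inr j))
    (hreg : ∀ v : Fin n ⊕ Fin n, 2 * G.degree v = n)
    (hham : G.IsHamiltonian)
    (v : Fin n ⊕ Fin n) (C : G.Walk v v) (hC : C.IsCycle) (hlen : C.length = 2 * n - 2)
    (x' y' : Fin n ⊕ Fin n) (hx' : x' ∉ C.support) (hy' : y' ∉ C.support)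
    (hadj : G.Adj x' y') :
    ∀ ℓ : ℕ, Even ℓ → 4 ≤ ℓ → ℓ ≤ 2 * n →
      ∃ (w : Fin n ⊕ Fin n) (c : G.Walk w w), c.IsCycle ∧ c.length = ℓ := by
  intro ℓ hℓe hℓ4 hℓn
  obtain ⟨k, rfl⟩ : ∃ k, n = 2 * k := ⟨G.degree x', (hreg x').symm⟩
  obtain ⟨h, rfl⟩ : ∃ h, ℓ = 2 * h + 2 := by
    obtain ⟨r, rfl⟩ := hℓe
    exact ⟨r - 1, by omega⟩
  have hcard : Fintype.card (Fin (2 * k) ⊕ Fin (2 * k)) = 4 * k := by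
    simp only [Fintype.card_sum, Fintype.card_fin]
    omega
  rcases (by omega : h < 2 * k - 1 ∨ h = 2 * k - 2 + 1) with hlt | rfl
  · have : NeZero (2 * (2 * k - 1)) := ⟨by omega⟩
    obtain ⟨c, hc, hadj', hmem⟩ :=
      hC.exists_zmod_parametrisation (N := 2 * (2 * k - 1)) (by omega)
    refine SimpleGraph.hasCycleOfLength_of_regular (col := Sum.isLeft) (m := 2 * k - 1) (k := k)
      ?_ (by omega) (by omega) (by omega) ?_ hc hadj' ?_ ?_ hadj (by omega) hlt
    · rintro (i | i) (j | j) hij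
      · exact absurd hij (hbip i j).1
      · simp
      · simp
      · exact absurd hij (hbip i j).2
    · intro w
      have := hreg w
      rw [← SimpleGraph.card_neighborFinset_eq_degree, SimpleGraph.neighborFinset_eq_filter] at this
      have hw : ({w' | G.Adj w w'} : Finset _).card = k := by omega
      convert hw
    · rintro u rfl
      exact hx' (hmem u)
    · rintro u rfl
      exact hy' (hmem u)
  · obtain ⟨a, p, hp⟩ := hham (by omega)
    exact ⟨a, p, hp.isCycle, by rw [hp.length_eq, hcard]; omega⟩
end

section
/- Let n ≥ 3 and let G be a bipartite graph with colour classes X = {x₁,…,xₙ} and Y = {y₁,…,yₙ} containing the Hamilton cycle H = x₁y₁x₂y₂…xₙyₙx₁ (all indices taken modulo n). Suppose that for some indices i and j with j ∈ {i+2, i+3, …, n+i−3} (modulo n) both xᵢy_j ∈ E(G) and x_{i+1}y_{j+1} ∈ E(G). Then G contains a cycle of length 2n − 2 (one avoiding exactly the two vertices x_{j+1} and y_i). -/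
namespace SimpleGraph

/-- A sequence of consecutively adjacent vertices spans a walk. -/
theorem exists_walk_of_adj_succ {V : Type*} {G : SimpleGraph V} (f : ℕ → V) (N : ℕ)
    (hadj : ∀ k < N, G.Adj (f k) (f (k + 1))) :
    ∃ p : G.Walk (f 0) (f N), p.support = (List.range (N + 1)).map f ∧
      ∀ e ∈ p.edges, ∃ k < N, e = s(f k, f (k + 1)) := by
  induction N with
  | zero => exact ⟨Walk.nil, by simp, by simp⟩
  | succ N ih =>
    obtain ⟨p, hs, he⟩ := ih fun k hk => hadj k (by omega)
    refine ⟨p.concat (hadj N (by omega)), ?_, fun e h => ?_⟩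
    · rw [Walk.support_concat, hs, List.range_succ (n := N + 1)]
      simp
    · rw [Walk.edges_concat, List.concat_eq_append, List.mem_append, List.mem_singleton] at h
      rcases h with h | h
      · obtain ⟨k, hk, rfl⟩ := he e h
        exact ⟨k, by omega, rfl⟩
      · exact ⟨N, by omega, h⟩

/-- An injective cyclic sequence of at least three consecutively adjacent vertices spans a
cycle. -/
theorem exists_isCycle_of_adj_succ {V : Type*} {G : SimpleGraph V} (f : ℕ → V) (N : ℕ)
    (hN : 2 ≤ N) (hadj : ∀ k < N, G.Adj (f k) (f (k + 1))) (hclose : G.Adj (f N) (f 0))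
    (hinj : ∀ a ≤ N, ∀ b ≤ N, f a = f b → a = b) :
    ∃ c : G.Walk (f N) (f N), c.IsCycle ∧ c.length = N + 1 ∧
      ∀ u, u ∈ c.support ↔ ∃ k ≤ N, u = f k := by
  obtain ⟨p, hs, he⟩ := exists_walk_of_adj_succ f N hadj
  refine ⟨Walk.cons hclose p, ?_, ?_, fun u => ?_⟩
  · rw [Walk.cons_isCycle_iff, Walk.isPath_def, hs]
    refine ⟨List.Nodup.map_on (fun a ha b hb h => ?_) List.nodup_range, fun h => ?_⟩
    · rw [List.mem_range] at ha hb
      exact hinj a (by omega) b (by omega) h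
    · obtain ⟨k, hk, h⟩ := he _ h
      rw [Sym2.eq_iff] at h
      rcases h with ⟨h₁, -⟩ | ⟨h₁, h₂⟩
      · have := hinj _ le_rfl _ hk.le h₁
        omega
      · have := hinj _ le_rfl _ hk h₁
        have := hinj _ (Nat.zero_le N) _ hk.le h₂
        omega
  · have := congrArg List.length hs
    simpa using this
  · rw [Walk.support_cons, hs]
    simp only [List.mem_cons, List.mem_map, List.mem_range]
    constructor
    · rintro (rfl | ⟨k, hk, rfl⟩)
      · exact ⟨N, le_rfl, rfl⟩
      · exact ⟨k, by omega, rfl⟩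
    · rintro ⟨k, hk, rfl⟩
      exact Or.inr ⟨k, by omega, rfl⟩

end SimpleGraph

/-- The vertices `xᵢ, yᵢ, xᵢ₊₁, yᵢ₊₁, …` in the order of the Hamilton cycle. -/
def hamiltonSeq {n : ℕ} (i : ZMod n) (k : ℕ) : ZMod n ⊕ ZMod n :=
  if k % 2 = 0 then Sum.inl (i + (k / 2 : ℕ)) else Sum.inr (i + (k / 2 : ℕ))

theorem hamiltonSeq_even {n : ℕ} (i : ZMod n) (t : ℕ) :
    hamiltonSeq i (2 * t) = Sum.inl (i + t) := by
  simp [hamiltonSeq]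

theorem hamiltonSeq_odd {n : ℕ} (i : ZMod n) (t : ℕ) :
    hamiltonSeq i (2 * t + 1) = Sum.inr (i + t) := by
  have h : (2 * t + 1) / 2 = t := by omega
  simp [hamiltonSeq, Nat.add_mod, h]

theorem hamiltonSeq_adj_succ {n : ℕ} {G : SimpleGraph (ZMod n ⊕ ZMod n)}
    (hH : ∀ i : ZMod n, G.Adj (Sum.inl i) (Sum.inr i) ∧ G.Adj (Sum.inl (i + 1)) (Sum.inr i))
    (i : ZMod n) (k : ℕ) : G.Adj (hamiltonSeq i k) (hamiltonSeq i (k + 1)) := by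
  obtain ⟨t, rfl | rfl⟩ := Nat.even_or_odd' k
  · rw [hamiltonSeq_even, hamiltonSeq_odd]
    exact (hH _).1
  · rw [hamiltonSeq_odd, show 2 * t + 1 + 1 = 2 * (t + 1) by ring, hamiltonSeq_even,
      Nat.cast_succ, ← add_assoc]
    exact (hH _).2.symm

theorem ZMod.natCast_inj_of_lt {n a b : ℕ} (ha : a < n) (hb : b < n)
    (h : (a : ZMod n) = b) : a = b := by
  rwa [ZMod.natCast_eq_natCast_iff', Nat.mod_eq_of_lt ha, Nat.mod_eq_of_lt hb] at h

theorem hamiltonSeq_injOn {n : ℕ} (i : ZMod n) {a b : ℕ} (ha : a < 2 * n) (hb : b < 2 * n)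
    (h : hamiltonSeq i a = hamiltonSeq i b) : a = b := by
  obtain ⟨s, rfl | rfl⟩ := Nat.even_or_odd' a <;> obtain ⟨t, rfl | rfl⟩ := Nat.even_or_odd' b <;>
    simp only [hamiltonSeq_even, hamiltonSeq_odd, Sum.inl.injEq, Sum.inr.injEq, reduceCtorEq,
      add_right_inj] at h <;>
    have := ZMod.natCast_inj_of_lt (by omega) (by omega) h <;> omega

theorem exists_hamiltonSeq_eq {n : ℕ} [NeZero n] (i : ZMod n) (u : ZMod n ⊕ ZMod n) :
    ∃ k < 2 * n, hamiltonSeq i k = u := by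
  rcases u with a | a
  · have := ZMod.val_lt (a - i)
    exact ⟨2 * (a - i).val, by omega, by rw [hamiltonSeq_even]; simp⟩
  · have := ZMod.val_lt (a - i)
    exact ⟨2 * (a - i).val + 1, by omega, by rw [hamiltonSeq_odd]; simp⟩

/-- The positions on the Hamilton cycle visited by the shorter cycle: after `0`, descend from
`2 * m + 1` to `2`, then ascend from `2 * m + 3`. -/
def detour (m k : ℕ) : ℕ :=
  if k = 0 then 0 else if k ≤ 2 * m then 2 * m + 2 - k else k + 2

/-- Let `G` be a bipartite graph with colour classes `X = {xᵢ}` and `Y = {yᵢ}` (indices in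
`ZMod n`, `n ≥ 3`, with `x i = Sum.inl i` and `y i = Sum.inr i`) containing the Hamilton
cycle `x₁y₁x₂y₂…xₙyₙx₁`.  Suppose that for some index `i` and some `j = i + m` with
`2 ≤ m ≤ n - 3` both `xᵢy_j ∈ E(G)` and `x_{i+1}y_{j+1} ∈ E(G)`.  Then `G` contains a
cycle of length `2n - 2`, one avoiding exactly the two vertices `x_{j+1}` and `y_i`. -/
theorem cycle_of_parallel_chords
    (n : ℕ) (hn : 3 ≤ n) (G : SimpleGraph (ZMod n ⊕ ZMod n))
    (hbip : ∀ i j : ZMod n, ¬ G.Adj (Sum.inl i) (Sum.inl j) ∧ ¬ G.Adj (Sum.inr i) (Sum.inr j))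
    (hH : ∀ i : ZMod n, G.Adj (Sum.inl i) (Sum.inr i) ∧ G.Adj (Sum.inl (i + 1)) (Sum.inr i))
    (i : ZMod n) (m : ℕ) (hm : 2 ≤ m) (hm' : m ≤ n - 3)
    (hchord₁ : G.Adj (Sum.inl i) (Sum.inr (i + (m : ZMod n))))
    (hchord₂ : G.Adj (Sum.inl (i + 1)) (Sum.inr (i + (m : ZMod n) + 1))) :
    ∃ (v : ZMod n ⊕ ZMod n) (c : G.Walk v v), c.IsCycle ∧ c.length = 2 * n - 2 ∧
      ∀ u : ZMod n ⊕ ZMod n,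
        u ∈ c.support ↔ (u ≠ Sum.inl (i + (m : ZMod n) + 1) ∧ u ≠ Sum.inr i) := by
  have : NeZero n := ⟨by omega⟩
  have h_zero : hamiltonSeq i 0 = Sum.inl i := by simpa using hamiltonSeq_even i 0
  have h_one : hamiltonSeq i 1 = Sum.inr i := by simpa using hamiltonSeq_odd i 0
  have h_two : hamiltonSeq i 2 = Sum.inl (i + 1) := by simpa using hamiltonSeq_even i 1
  have h_last : hamiltonSeq i (2 * n) = Sum.inl i := by simpa using hamiltonSeq_even i n
  have h_skip : hamiltonSeq i (2 * m + 2) = Sum.inl (i + (m : ZMod n) + 1) := by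
    simpa [mul_add, add_assoc] using hamiltonSeq_even i (m + 1)
  have h_next : hamiltonSeq i (2 * m + 3) = Sum.inr (i + (m : ZMod n) + 1) := by
    simpa [mul_add, add_assoc] using hamiltonSeq_odd i (m + 1)
  have hsucc := hamiltonSeq_adj_succ hH i
  have hadj : ∀ k < 2 * n - 3,
      G.Adj (hamiltonSeq i (detour m k)) (hamiltonSeq i (detour m (k + 1))) := by
    intro k hk
    rcases Nat.eq_zero_or_pos k with rfl | hpos
    · rw [show detour m 0 = 0 from rfl, show detour m (0 + 1) = 2 * m + 1 by
        grind [detour], h_zero, hamiltonSeq_odd]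
      exact hchord₁
    rcases lt_trichotomy k (2 * m) with h | rfl | h
    · rw [show detour m k = detour m (k + 1) + 1 by grind [detour]]
      exact (hsucc _).symm
    · rw [show detour m (2 * m) = 2 by grind [detour],
        show detour m (2 * m + 1) = 2 * m + 3 by grind [detour],
        h_two, h_next]
      exact hchord₂
    · rw [show detour m (k + 1) = detour m k + 1 by grind [detour]]
      exact hsucc _
  have hclose : G.Adj (hamiltonSeq i (detour m (2 * n - 3))) (hamiltonSeq i (detour m 0)) := by
    have := hsucc (2 * n - 1)
    rw [show 2 * n - 1 + 1 = 2 * n by omega, h_last, ← h_zero] at this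
    rwa [show detour m (2 * n - 3) = 2 * n - 1 by grind [detour]]
  have hinj : ∀ a ≤ 2 * n - 3, ∀ b ≤ 2 * n - 3,
      hamiltonSeq i (detour m a) = hamiltonSeq i (detour m b) → a = b := by
    intro a ha b hb h
    have := hamiltonSeq_injOn i (by grind [detour]) (by grind [detour]) h
    unfold detour at this
    split_ifs at this <;> omega
  obtain ⟨c, hc, hlen, hsupp⟩ := SimpleGraph.exists_isCycle_of_adj_succ
    (fun k => hamiltonSeq i (detour m k)) (2 * n - 3) (by omega) hadj hclose hinj
  refine ⟨_, c, hc, by omega, fun u => ?_⟩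
  rw [hsupp, ← h_skip, ← h_one]
  constructor
  · rintro ⟨k, hk, rfl⟩
    constructor <;> intro h <;>
      have := hamiltonSeq_injOn i (by grind [detour]) (by omega) h <;>
      unfold detour at this <;> split_ifs at this <;> omega
  · rintro ⟨h₁, h₂⟩
    obtain ⟨k, hk, rfl⟩ := exists_hamiltonSeq_eq i u
    have hk₁ : k ≠ 2 * m + 2 := fun h => h₁ (by rw [h])
    have hk₂ : k ≠ 1 := fun h => h₂ (by rw [h])
    refine ⟨if k = 0 then 0 else if k < 2 * m + 2 then 2 * m + 2 - k else k - 2, ?_, ?_⟩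
    · split_ifs <;> omega
    · congr 1
      unfold detour
      split_ifs <;> omega
end

section
/- Let n ≥ 5 and let G be a bipartite graph with colour classes X = {x₁,…,xₙ} and Y = {y₁,…,yₙ} containing the Hamilton cycle H = x₁y₁x₂y₂…xₙyₙx₁ (all indices taken modulo n). Suppose that for some index i₀ and some k ∈ {3, 4, …, n−3} the three edges x_{i₀−1}y_{i₀+1}, x_{i₀}y_{i₀+k}, and x_{i₀+k}y_{i₀} all belong to E(G). Then G contains a cycle of length 2n − 2, namely the cycle x_{i₀−1} y_{i₀+1} x_{i₀+2} … y_{i₀+k−1} x_{i₀+k} y_{i₀} x_{i₀} y_{i₀+k} x_{i₀+k+1} … y_{i₀−2} x_{i₀−1}, which avoids exactly x_{i₀+1} and y_{i₀−1}. -/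
namespace SimpleGraph

variable {V : Type*} {G : SimpleGraph V}

theorem exists_walk_support_eq_map_range (f : ℕ → V) (m : ℕ)
    (hf : ∀ j < m, G.Adj (f j) (f (j + 1))) :
    ∃ p : G.Walk (f m) (f 0), p.support = ((List.range (m + 1)).map f).reverse := by
  induction m with
  | zero => exact ⟨.nil, by simp⟩
  | succ m ih =>
    obtain ⟨p, hp⟩ := ih fun j hj => hf j (by lia)
    refine ⟨.cons (hf m (by lia)).symm p, ?_⟩
    rw [List.range_succ, List.map_append, List.reverse_append, Walk.support_cons, hp]
    simp

theorem exists_isCycle_of_injOn_s6 (f : ℕ → V) (m : ℕ) (hm : 2 ≤ m)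
    (hf : ∀ j < m, G.Adj (f j) (f (j + 1))) (hlast : G.Adj (f 0) (f m))
    (hinj : Set.InjOn f (Set.Iic m)) :
    ∃ c : G.Walk (f 0) (f 0), c.IsCycle ∧ c.length = m + 1 ∧
      ∀ u, u ∈ c.support ↔ ∃ j ≤ m, f j = u := by
  obtain ⟨p, hp⟩ := exists_walk_support_eq_map_range f m hf
  have hlen : p.length = m := by
    have := congrArg List.length hp
    simpa using this
  have hpath : p.IsPath := by
    rw [Walk.isPath_def, hp, List.nodup_reverse]
    refine List.nodup_range.map_on fun i hi j hj h => hinj ?_ ?_ h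
    · simpa [Nat.lt_succ_iff] using hi
    · simpa [Nat.lt_succ_iff] using hj
  refine ⟨.cons hlast p, ?_, by simp [hlen], fun u => ?_⟩
  · refine (Walk.cons_isCycle_iff p hlast).2 ⟨hpath, fun hmem => ?_⟩
    rw [Sym2.eq_swap] at hmem
    have := hpath.length_eq_one_of_mem_edges hmem
    lia
  · have hsupp : u ∈ p.support ↔ ∃ j ≤ m, f j = u := by
      simp [hp]
    rw [Walk.support_cons, List.mem_cons, hsupp, or_iff_right_iff_imp]
    rintro rfl
    exact ⟨0, by lia, rfl⟩

theorem exists_isCycle_of_alternating (x y : ℕ → V) (m : ℕ) (hm : 1 ≤ m)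
    (hyx : ∀ t, G.Adj (y t) (x t)) (hxy : ∀ t, G.Adj (x t) (y (t + 1)))
    (hlast : G.Adj (y 0) (x m)) (hx : Set.InjOn x (Set.Iic m)) (hy : Set.InjOn y (Set.Iic m))
    (hne : ∀ s t, x s ≠ y t) :
    ∃ (v : V) (c : G.Walk v v), c.IsCycle ∧ c.length = 2 * m + 2 ∧
      ∀ u, u ∈ c.support ↔ ∃ t ≤ m, y t = u ∨ x t = u := by
  obtain ⟨f, hfy, hfx⟩ : ∃ f : ℕ → V, (∀ t, f (2 * t) = y t) ∧ ∀ t, f (2 * t + 1) = x t :=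
    ⟨fun j => if j % 2 = 0 then y (j / 2) else x (j / 2),
      fun t => by simp, fun t => by simp [Nat.add_mod, show (2 * t + 1) / 2 = t by lia]⟩
  have hadj : ∀ j < 2 * m + 1, G.Adj (f j) (f (j + 1)) := by
    intro j _
    obtain ⟨t, rfl | rfl⟩ := j.even_or_odd'
    · rw [hfy, hfx]
      exact hyx t
    · rw [hfx, show 2 * t + 1 + 1 = 2 * (t + 1) by lia, hfy]
      exact hxy t
  have hinj : Set.InjOn f (Set.Iic (2 * m + 1)) := by
    intro i hi j hj h
    rw [Set.mem_Iic] at hi hj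
    obtain ⟨s, rfl | rfl⟩ := i.even_or_odd' <;> obtain ⟨t, rfl | rfl⟩ := j.even_or_odd'
    · rw [hfy, hfy] at h
      rw [hy (Set.mem_Iic.2 (by lia)) (Set.mem_Iic.2 (by lia)) h]
    · rw [hfy, hfx] at h
      exact absurd h.symm (hne _ _)
    · rw [hfx, hfy] at h
      exact absurd h (hne _ _)
    · rw [hfx, hfx] at h
      rw [hx (Set.mem_Iic.2 (by lia)) (Set.mem_Iic.2 (by lia)) h]
  obtain ⟨c, hc, hlen, hsupp⟩ := exists_isCycle_of_injOn_s6 f (2 * m + 1) (by lia) hadj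
    (by rwa [hfx, ← Nat.mul_zero 2, hfy]) hinj
  refine ⟨_, c, hc, hlen, fun u => (hsupp u).trans ⟨?_, ?_⟩⟩
  · rintro ⟨j, hj, rfl⟩
    obtain ⟨t, rfl | rfl⟩ := j.even_or_odd'
    · exact ⟨t, by lia, .inl (hfy t).symm⟩
    · exact ⟨t, by lia, .inr (hfx t).symm⟩
  · rintro ⟨t, ht, h | h⟩
    · exact ⟨2 * t, by lia, (hfy t).trans h⟩
    · exact ⟨2 * t + 1, by lia, (hfx t).trans h⟩

end SimpleGraph

theorem ZMod.injOn_add_natCast (n : ℕ) (a : ZMod n) :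
    Set.InjOn (fun w : ℕ => a + (w : ZMod n)) (Set.Iio n) := fun v hv w hw h => by
  rw [add_right_inj, ZMod.natCast_eq_natCast_iff'] at h
  rwa [Nat.mod_eq_of_lt hv, Nat.mod_eq_of_lt hw] at h

theorem ZMod.exists_lt_add_natCast_eq (n : ℕ) [NeZero n] (a z : ZMod n) :
    ∃ w < n, a + (w : ZMod n) = z :=
  ⟨(z - a).val, ZMod.val_lt _, by simp⟩


/-- Let `G` be a bipartite graph with colour classes `X = {xᵢ}` and `Y = {yᵢ}` (indices in
`ZMod n`, `n ≥ 5`, with `x i = Sum.inl i` and `y i = Sum.inr i`) containing the Hamilton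
cycle `x₁y₁x₂y₂…xₙyₙx₁`.  If for some index `i₀` and some `k ∈ {3, …, n-3}` the three
edges `x_{i₀-1}y_{i₀+1}`, `x_{i₀}y_{i₀+k}` and `x_{i₀+k}y_{i₀}` all belong to `E(G)`,
then `G` contains a cycle of length `2n - 2` avoiding exactly the two vertices
`x_{i₀+1}` and `y_{i₀-1}`. -/
theorem cycle_of_three_chords
    (n : ℕ) (hn : 5 ≤ n) (G : SimpleGraph (ZMod n ⊕ ZMod n))
    (hbip : ∀ i j : ZMod n, ¬ G.Adj (Sum.inl i) (Sum.inl j) ∧ ¬ G.Adj (Sum.inr i) (Sum.inr j))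
    (hH : ∀ i : ZMod n, G.Adj (Sum.inl i) (Sum.inr i) ∧ G.Adj (Sum.inl (i + 1)) (Sum.inr i))
    (i₀ : ZMod n) (k : ℕ) (hk : 3 ≤ k) (hk' : k ≤ n - 3)
    (hchord₁ : G.Adj (Sum.inl (i₀ - 1)) (Sum.inr (i₀ + 1)))
    (hchord₂ : G.Adj (Sum.inl i₀) (Sum.inr (i₀ + (k : ZMod n))))
    (hchord₃ : G.Adj (Sum.inl (i₀ + (k : ZMod n))) (Sum.inr i₀)) :
    ∃ (v : ZMod n ⊕ ZMod n) (c : G.Walk v v), c.IsCycle ∧ c.length = 2 * n - 2 ∧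
      ∀ u : ZMod n ⊕ ZMod n,
        u ∈ c.support ↔ (u ≠ Sum.inl (i₀ + 1) ∧ u ≠ Sum.inr (i₀ - 1)) := by
  have : NeZero n := ⟨by lia⟩
  have hinj := ZMod.injOn_add_natCast n i₀
  have hsurj := ZMod.exists_lt_add_natCast_eq n i₀
  have hpred : i₀ + ((n - 1 : ℕ) : ZMod n) = i₀ - 1 := by
    rw [Nat.cast_sub (by lia)]
    simp [sub_eq_add_neg]
  obtain ⟨X, hX⟩ : ∃ X : ℕ → ZMod n ⊕ ZMod n, ∀ w, X w = Sum.inl (i₀ + (w : ZMod n)) :=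
    ⟨_, fun _ => rfl⟩
  obtain ⟨Y, hY⟩ : ∃ Y : ℕ → ZMod n ⊕ ZMod n, ∀ w, Y w = Sum.inr (i₀ + (w : ZMod n)) :=
    ⟨_, fun _ => rfl⟩
  have hXY (v w : ℕ) : X v ≠ Y w := by simp [hX, hY]
  have hXinj (v w : ℕ) (hv : v < n) (hw : w < n) (h : X v = X w) : v = w :=
    hinj hv hw (by simpa [hX] using h)
  have hYinj (v w : ℕ) (hv : v < n) (hw : w < n) (h : Y v = Y w) : v = w :=
    hinj hv hw (by simpa [hY] using h)
  have hcover (u : ZMod n ⊕ ZMod n) : ∃ w < n, u = X w ∨ u = Y w := by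
    rcases u with z | z <;> obtain ⟨w, hw, rfl⟩ := hsurj z
    · exact ⟨w, hw, .inl (hX w).symm⟩
    · exact ⟨w, hw, .inr (hY w).symm⟩
  have hsame (w : ℕ) : G.Adj (Y w) (X w) := by
    rw [hX, hY]
    exact (hH _).1.symm
  have hnext (w : ℕ) : G.Adj (Y w) (X (w + 1)) := by
    rw [hX, hY, Nat.cast_succ, ← add_assoc]
    exact (hH _).2.symm
  have hlast : G.Adj (Y 1) (X (n - 1)) := by
    rw [hX, hY, hpred, Nat.cast_one]
    exact hchord₁.symm
  have hXk : G.Adj (X 0) (Y k) := by simpa [hX, hY] using hchord₂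
  have hkY : G.Adj (X k) (Y 0) := by simpa [hX, hY] using hchord₃
  have hX1 : Sum.inl (i₀ + 1) = X 1 := by simp [hX]
  have hYlast : Sum.inr (i₀ - 1) = Y (n - 1) := by rw [hY, hpred]
  rw [hX1, hYlast]
  clear hX1 hYlast hchord₁ hchord₂ hchord₃ hH hbip hinj hsurj hpred hX hY
  -- The cycle visits `Y (a 0), X (b 0), Y (a 1), X (b 1), …, Y (a (n - 2)), X (b (n - 2))`.
  obtain ⟨a, ha⟩ : ∃ a : ℕ → ℕ, ∀ t,
      a t = if t + 1 < k then t + 1 else if t + 1 = k then 0 else t := ⟨_, fun _ => rfl⟩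
  obtain ⟨b, hb⟩ : ∃ b : ℕ → ℕ, ∀ t,
      b t = if t + 1 < k then t + 2 else if t + 1 = k then 0 else t + 1 := ⟨_, fun _ => rfl⟩
  have ha_lt (t : ℕ) (ht : t ≤ n - 2) : a t < n - 1 := by
    rw [ha]
    split_ifs <;> lia
  have hb_lt (t : ℕ) (ht : t ≤ n - 2) : b t < n ∧ b t ≠ 1 := by
    rw [hb]
    split_ifs <;> lia
  have ha_inj (s t : ℕ) (h : a s = a t) : s = t := by
    rw [ha, ha] at h
    split_ifs at h <;> lia
  have hb_inj (s t : ℕ) (h : b s = b t) : s = t := by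
    rw [hb, hb] at h
    split_ifs at h <;> lia
  have ha_surj (w : ℕ) (hw : w < n - 1) : ∃ t ≤ n - 2, a t = w := by
    refine ⟨if w = 0 then k - 1 else if w < k then w - 1 else w, ?_, ?_⟩
    · split_ifs <;> lia
    · rw [ha]
      split_ifs <;> lia
  have hb_surj (w : ℕ) (hw : w < n) (hw₁ : w ≠ 1) : ∃ t ≤ n - 2, b t = w := by
    refine ⟨if w = 0 then k - 1 else if w ≤ k then w - 2 else w - 1, ?_, ?_⟩
    · split_ifs <;> lia
    · rw [hb]
      split_ifs <;> lia
  have hYX (t : ℕ) : G.Adj (Y (a t)) (X (b t)) := by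
    rw [ha, hb]
    split_ifs
    exacts [hnext (t + 1), hsame 0, hnext t]
  have hXYnext (t : ℕ) : G.Adj (X (b t)) (Y (a (t + 1))) := by
    have h₁ := (hsame (t + 2)).symm
    have h₂ := (hsame (t + 1)).symm
    grind
  have ha_zero : a 0 = 1 := by rw [ha, if_pos (by lia)]
  have hb_last : b (n - 2) = n - 1 := by
    rw [hb, if_neg (by lia), if_neg (by lia)]
    lia
  obtain ⟨v, c, hc, hlen, hsupp⟩ := G.exists_isCycle_of_alternating (X ∘ b) (Y ∘ a) (n - 2)
    (by lia) hYX hXYnext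
    (by rwa [Function.comp_apply, Function.comp_apply, ha_zero, hb_last])
    (fun s hs t ht h => hb_inj s t (hXinj _ _ (hb_lt s hs).1 (hb_lt t ht).1 h))
    (fun s hs t ht h => ha_inj s t
      (hYinj _ _ ((ha_lt s hs).trans_le (n.sub_le 1)) ((ha_lt t ht).trans_le (n.sub_le 1)) h))
    (fun _ _ => hXY _ _)
  refine ⟨v, c, hc, by lia, fun u => (hsupp u).trans ⟨?_, ?_⟩⟩
  · rintro ⟨t, ht, rfl | rfl⟩
    · exact ⟨(hXY _ _).symm, fun h =>
        (ha_lt t ht).ne (hYinj _ _ ((ha_lt t ht).trans_le (n.sub_le 1)) (by lia) h)⟩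
    · exact ⟨fun h => (hb_lt t ht).2 (hXinj _ _ (hb_lt t ht).1 (by lia) h), hXY _ _⟩
  · rintro ⟨h₁, h₂⟩
    obtain ⟨w, hw, rfl | rfl⟩ := hcover u
    · obtain ⟨t, ht, rfl⟩ := hb_surj w hw fun h => h₁ (congrArg X h)
      exact ⟨t, ht, .inr rfl⟩
    · obtain ⟨t, ht, rfl⟩ := ha_surj w (by
        have : w ≠ n - 1 := fun h => h₂ (congrArg Y h)
        lia)
      exact ⟨t, ht, .inl rfl⟩
end

section
/- Let n ≥ 5 and let A = [aⁱⱼ] be an n × n matrix with entries in {−1, +1}, with indices understood modulo n, satisfying: (i) aⁱ_{i−1} = aⁱᵢ = 1 and aⁱ_{i−2} = aⁱ_{i+1} = −1 for every i; (ii) a^{i+1}_{j+1} = −aⁱⱼ whenever j ∈ {i+2, …, n+i−3} (modulo n); (iii) every row of A sums to 0; and (iv) every column of A sums to 0. Then n ≡ 0 (mod 4), and for every index i₀ one has a^{i₀}_{i₀+2} + a^{i₀}_{i₀+4} + ⋯ + a^{i₀}_{i₀+n−4} = 0 and a^{i₀}_{i₀+3} + a^{i₀}_{i₀+5} + ⋯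 + a^{i₀}_{i₀+n−3} = 0. -/
theorem sum_zmod_eq_sum_range {M : Type*} [AddCommMonoid M] (n : ℕ) [NeZero n] (f : ZMod n → M) :
    ∑ j : ZMod n, f j = ∑ m ∈ Finset.range n, f (m : ZMod n) := by
  symm
  refine Finset.sum_bij (fun (m : ℕ) _ => (m : ZMod n)) (fun _ _ => Finset.mem_univ _) ?_ ?_ ?_
  · intro a ha b hb hab
    have h := congrArg ZMod.val hab
    rwa [ZMod.val_cast_of_lt (Finset.mem_range.1 ha),
      ZMod.val_cast_of_lt (Finset.mem_range.1 hb)] at h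
  · exact fun b _ => ⟨b.val, Finset.mem_range.2 b.val_lt, ZMod.natCast_zmod_val b⟩
  · exact fun _ _ => rfl

theorem sum_range_two_mul_add_four {M : Type*} [AddCommMonoid M] (f : ℕ → M) (p : ℕ) :
    ∑ m ∈ Finset.range (2 * p + 4), f m =
      f 0 + f 1 + (∑ t ∈ Finset.range p, f (2 * t + 2) + ∑ t ∈ Finset.range p, f (2 * t + 3)) +
        f (2 * p + 2) + f (2 * p + 3) := by
  induction p with
  | zero => simp [Finset.sum_range_succ]
  | succ p ih =>
    rw [show 2 * (p + 1) + 4 = 2 * p + 4 + 1 + 1 by ring, Finset.sum_range_succ,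
      Finset.sum_range_succ, ih, Finset.sum_range_succ, Finset.sum_range_succ,
      show 2 * (p + 1) + 2 = 2 * p + 4 by ring, show 2 * (p + 1) + 3 = 2 * p + 4 + 1 by ring]
    abel

theorem even_of_sum_range_eq_zero {f : ℕ → ℤ} (hf : ∀ t, f t = 1 ∨ f t = -1) {p : ℕ}
    (h : ∑ t ∈ Finset.range p, f t = 0) : Even p := by
  have key : ∀ q : ℕ, (2 : ℤ) ∣ ∑ t ∈ Finset.range q, f t - q := by
    intro q
    induction q with
    | zero => simp
    | succ q ih =>
      rw [Finset.sum_range_succ]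
      push_cast
      rcases hf q with h | h <;> omega
  have hp := key p
  rw [h] at hp
  rw [Nat.even_iff]
  omega

theorem apply_add_natCast_of_alternating {R : Type*} [AddMonoidWithOne R] {b : R → ℤ}
    (hb : ∀ i, b (i + 1) = -b i) (i : R) (k : ℕ) : b (i + k) = (-1) ^ k * b i := by
  induction k with
  | zero => simp
  | succ k ih => rw [Nat.cast_succ, ← add_assoc, hb, ih]; ring


/-- Let `n ≥ 5` and let `A` be an `n × n` matrix with entries in `{-1, +1}` and indices
understood modulo `n`, satisfying (i) `aⁱ_{i-1} = aⁱᵢ = 1`, `aⁱ_{i-2} = aⁱ_{i+1} = -1`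
for every `i`, (ii) `a^{i+1}_{j+1} = -aⁱⱼ` whenever `j = i + m` with `2 ≤ m ≤ n - 3`,
(iii) every row sums to `0`, and (iv) every column sums to `0`.  Then `n ≡ 0 (mod 4)`,
and for every `i₀` both `a^{i₀}_{i₀+2} + a^{i₀}_{i₀+4} + ⋯ + a^{i₀}_{i₀+n-4} = 0` and
`a^{i₀}_{i₀+3} + a^{i₀}_{i₀+5} + ⋯ + a^{i₀}_{i₀+n-3} = 0`. -/
theorem matrix_alternating_sums_zero
    (n : ℕ) (hn : 5 ≤ n) [NeZero n] (A : ZMod n → ZMod n → ℤ)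
    (hpm : ∀ i j : ZMod n, A i j = 1 ∨ A i j = -1)
    (h1 : ∀ i : ZMod n, A i (i - 1) = 1 ∧ A i i = 1 ∧ A i (i - 2) = -1 ∧ A i (i + 1) = -1)
    (h2 : ∀ (i : ZMod n) (m : ℕ), 2 ≤ m → m ≤ n - 3 →
      A (i + 1) (i + (m : ZMod n) + 1) = - A i (i + (m : ZMod n)))
    (hrow : ∀ i : ZMod n, ∑ j : ZMod n, A i j = 0)
    (hcol : ∀ j : ZMod n, ∑ i : ZMod n, A i j = 0) :
    n % 4 = 0 ∧
      ∀ i₀ : ZMod n,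
        (∑ t ∈ Finset.range ((n - 4) / 2), A i₀ (i₀ + ((2 * t + 2 : ℕ) : ZMod n))) = 0 ∧
        (∑ t ∈ Finset.range ((n - 4) / 2), A i₀ (i₀ + ((2 * t + 3 : ℕ) : ZMod n))) = 0 := by
  have hshift (i : ZMod n) (m : ℕ) (hm : 2 ≤ m) (hm' : m ≤ n - 3) (k : ℕ) :
      A (i + k) (i + k + m) = (-1) ^ k * A i (i + m) := by
    refine apply_add_natCast_of_alternating (b := fun i => A i (i + m)) (fun i => ?_) i k
    rw [← h2 i m hm hm', add_right_comm]
  have hne (i j : ZMod n) : A i j ≠ 0 := by rcases hpm i j with h | h <;> simp [h]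
  have hn_even : Even n := by
    by_contra hodd
    have h := hshift 0 2 le_rfl (by omega) n
    rw [(Nat.not_even_iff_odd.1 hodd).neg_one_pow, ZMod.natCast_self, add_zero] at h
    exact hne 0 (0 + (2 : ℕ)) (by linarith)
  obtain ⟨p, rfl⟩ : ∃ p, n = 2 * p + 4 := by
    obtain ⟨q, rfl⟩ := hn_even
    exact ⟨q - 2, by omega⟩
  rw [show (2 * p + 4 - 4) / 2 = p by omega]
  have hz : (((2 * p + 4 : ℕ)) : ZMod (2 * p + 4)) = 0 := ZMod.natCast_self _
  have hz2 : ((2 * p + 2 : ℕ) : ZMod (2 * p + 4)) = -2 := by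
    push_cast at hz ⊢; linear_combination hz
  have hz3 : ((2 * p + 3 : ℕ) : ZMod (2 * p + 4)) = -1 := by
    push_cast at hz ⊢; linear_combination hz
  have hsums (i : ZMod (2 * p + 4)) :
      (∑ t ∈ Finset.range p, A i (i + ((2 * t + 2 : ℕ) : ZMod (2 * p + 4)))) = 0 ∧
        (∑ t ∈ Finset.range p, A i (i + ((2 * t + 3 : ℕ) : ZMod (2 * p + 4)))) = 0 := by
    have hr := hrow i
    rw [← Equiv.sum_comp (Equiv.addLeft i), sum_zmod_eq_sum_range,
      sum_range_two_mul_add_four] at hr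
    have hc := hcol i
    rw [← Equiv.sum_comp (Equiv.subLeft i), sum_zmod_eq_sum_range,
      sum_range_two_mul_add_four] at hc
    simp only [Equiv.coe_addLeft, Equiv.subLeft_apply, hz2, hz3, Nat.cast_zero, Nat.cast_one,
      add_zero, sub_zero, sub_neg_eq_add, ← sub_eq_add_neg] at hr hc
    have hcolumn (m : ℕ) (hm : 2 ≤ m) (hm' : m ≤ 2 * p + 1) :
        A i (i + m) = (-1) ^ m * A (i - m) i := by
      have h := hshift (i - m) m hm (by omega) m
      rwa [sub_add_cancel] at h
    have heven : ∑ t ∈ Finset.range p, A (i - ((2 * t + 2 : ℕ) : ZMod (2 * p + 4))) i =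
        ∑ t ∈ Finset.range p, A i (i + ((2 * t + 2 : ℕ) : ZMod (2 * p + 4))) := by
      refine Finset.sum_congr rfl fun t ht => ?_
      have := Finset.mem_range.1 ht
      rw [hcolumn (2 * t + 2) (by omega) (by omega),
        Even.neg_one_pow (by simp [parity_simps]), one_mul]
    have hodd : ∑ t ∈ Finset.range p, A (i - ((2 * t + 3 : ℕ) : ZMod (2 * p + 4))) i =
        -∑ t ∈ Finset.range p, A i (i + ((2 * t + 3 : ℕ) : ZMod (2 * p + 4))) := by
      rw [← Finset.sum_neg_distrib]
      refine Finset.sum_congr rfl fun t ht => ?_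
      have := Finset.mem_range.1 ht
      rw [hcolumn (2 * t + 3) (by omega) (by omega),
        Odd.neg_one_pow ⟨t + 1, by ring⟩, neg_one_mul, neg_neg]
    obtain ⟨hprev, hdiag, hprev2, hnext⟩ := h1 i
    have cprev := (h1 (i + 1)).1
    have cprev2 := (h1 (i + 2)).2.2.1
    have cnext := (h1 (i - 1)).2.2.2
    rw [add_sub_cancel_right] at cprev cprev2
    rw [sub_add_cancel] at cnext
    rw [hprev, hdiag, hprev2, hnext] at hr
    rw [hdiag, cprev, cprev2, cnext, heven, hodd] at hc
    constructor <;> linarith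
  refine ⟨?_, hsums⟩
  have hp : Even p := even_of_sum_range_eq_zero (fun t => hpm _ _) (hsums 0).1
  obtain ⟨q, rfl⟩ := hp
  omega
end

section
/- Let n ≥ 5 and let A = [aⁱⱼ] be an n × n matrix with entries in {−1, +1}, with indices understood modulo n, satisfying: (i) aⁱ_{i−1} = aⁱᵢ = 1 and aⁱ_{i−2} = aⁱ_{i+1} = −1 for every i; (ii) a^{i+1}_{j+1} = −aⁱⱼ whenever j ∈ {i+2, …, n+i−3} (modulo n); (iii) every row of A sums to 0; and (iv) every column of A sums to 0. Then there exist an index i₀ and some k ∈ {3, 4, …, n−3} such that a^{i₀−1}_{i₀+1} = 1, a^{i₀}_{i₀+k} = 1, and a^{i₀+k}_{i₀} = 1. -/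
theorem ZMod.sum_eq_sum_range {M : Type*} [AddCommMonoid M] (n : ℕ) [NeZero n]
    (f : ZMod n → M) : ∑ j, f j = ∑ m ∈ Finset.range n, f m := by
  cases n with
  | zero => exact absurd rfl (NeZero.ne 0)
  | succ n =>
    rw [Finset.sum_range]
    exact Finset.sum_congr rfl fun j _ => congrArg f (Fin.cast_val_eq_self j).symm

theorem Finset.sum_range_two_mul {M : Type*} [AddCommMonoid M] (f : ℕ → M) (p : ℕ) :
    ∑ m ∈ range (2 * p), f m = ∑ q ∈ range p, (f (2 * q) + f (2 * q + 1)) := by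
  induction p with
  | zero => simp
  | succ p ih =>
    rw [Nat.mul_succ, sum_range_succ, sum_range_succ, ih, sum_range_succ, add_assoc]

theorem even_card_of_sum_sign_eq_zero {ι : Type*} [Fintype ι] (f : ι → ℤ)
    (hf : ∀ i, f i = 1 ∨ f i = -1) (h : ∑ i, f i = 0) : Even (Fintype.card ι) := by
  have key : (∑ i, f i : ℤ) ≡ ∑ _i : ι, 1 [ZMOD 2] := by
    refine Int.ModEq.sum fun i _ => ?_
    rcases hf i with h | h <;> rw [h]
    decide
  rw [h, Finset.sum_const, Finset.card_univ, nsmul_one] at key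
  have := Int.modEq_zero_iff_dvd.mp key.symm
  exact even_iff_two_dvd.mpr (by exact_mod_cast this)

/-- Along a diagonal on which consecutive entries alternate in sign, moving `t` steps multiplies
by `(-1) ^ t`. -/
theorem apply_add_eq_neg_one_pow_mul {R : Type*} [CommRing R] (A : R → R → ℤ) (m : R)
    (h : ∀ i, A (i + 1) (i + m + 1) = -A i (i + m)) (i : R) (t : ℕ) :
    A (i + t) (i + t + m) = (-1) ^ t * A i (i + m) := by
  induction t with
  | zero => simp
  | succ t ih =>
    have := h (i + t)
    rw [ih] at this
    rw [pow_succ, Nat.cast_succ, ← add_assoc, add_right_comm _ 1 m, this]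
    ring


/-- Let `n ≥ 5` and let `A` be an `n × n` matrix with entries in `{-1, +1}` and indices
understood modulo `n`, satisfying (i) `aⁱ_{i-1} = aⁱᵢ = 1`, `aⁱ_{i-2} = aⁱ_{i+1} = -1`
for every `i`, (ii) `a^{i+1}_{j+1} = -aⁱⱼ` whenever `j = i + m` with `2 ≤ m ≤ n - 3`,
(iii) every row sums to `0`, and (iv) every column sums to `0`.  Then there exist an
index `i₀` and some `k ∈ {3, …, n-3}` with
`a^{i₀-1}_{i₀+1} = a^{i₀}_{i₀+k} = a^{i₀+k}_{i₀} = 1`. -/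
theorem matrix_exists_good_chords
    (n : ℕ) (hn : 5 ≤ n) [NeZero n] (A : ZMod n → ZMod n → ℤ)
    (hpm : ∀ i j : ZMod n, A i j = 1 ∨ A i j = -1)
    (h1 : ∀ i : ZMod n, A i (i - 1) = 1 ∧ A i i = 1 ∧ A i (i - 2) = -1 ∧ A i (i + 1) = -1)
    (h2 : ∀ (i : ZMod n) (m : ℕ), 2 ≤ m → m ≤ n - 3 →
      A (i + 1) (i + (m : ZMod n) + 1) = - A i (i + (m : ZMod n)))
    (hrow : ∀ i : ZMod n, ∑ j : ZMod n, A i j = 0)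
    (hcol : ∀ j : ZMod n, ∑ i : ZMod n, A i j = 0) :
    ∃ (i₀ : ZMod n) (k : ℕ), 3 ≤ k ∧ k ≤ n - 3 ∧
      A (i₀ - 1) (i₀ + 1) = 1 ∧ A i₀ (i₀ + (k : ZMod n)) = 1 ∧
      A (i₀ + (k : ZMod n)) i₀ = 1 := by

  have hne : Even n := by
    simpa using even_card_of_sum_sign_eq_zero (A 0) (hpm 0) (hrow 0)
  obtain ⟨r, rfl⟩ : ∃ r, n = 2 * (r + 3) := by
    obtain ⟨p, hp⟩ := hne
    exact ⟨p - 3, by omega⟩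
  obtain ⟨i, hi⟩ : ∃ i, A (i - 1) (i + 1) = 1 := by
    have h := h2 0 2 le_rfl (by omega)
    rcases hpm 0 (0 + (2 : ℕ)) with h0 | h0
    · exact ⟨1, by rw [← h0]; norm_num⟩
    · rw [h0, neg_neg] at h
      exact ⟨2, by rw [← h]; norm_num⟩
  have hcast : (2 * (r + 3) : ZMod (2 * (r + 3))) = 0 := by
    exact_mod_cast ZMod.natCast_self (2 * (r + 3))
  have hanti (m : ℕ) (hm : 2 ≤ m) (hm' : m ≤ 2 * (r + 3) - 3) :
      A (i - m) i = (-1) ^ m * A i (i + m) := by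
    have h := apply_add_eq_neg_one_pow_mul A m
      (fun j => h2 j m hm hm') (i - m) m
    rw [sub_add_cancel] at h
    rw [h, ← mul_assoc, ← mul_pow]
    simp
  have hsum : ∑ m ∈ Finset.range (2 * (r + 3)), (A i (i + m) + A (i - m) i) = 0 := by
    rw [← ZMod.sum_eq_sum_range (2 * (r + 3)) (fun m => A i (i + m) + A (i - m) i),
      Finset.sum_add_distrib]
    have hr := Equiv.sum_comp (Equiv.addLeft i) (A i)
    have hc := Equiv.sum_comp (Equiv.subLeft i) fun j => A j i
    simp only [Equiv.coe_addLeft, Equiv.subLeft_apply] at hr hc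
    rw [hr, hc, hrow, hcol, add_zero]
  have hmid (q : ℕ) (hq : q < r + 1) :
      A i (i + (2 * (q + 1) : ℕ)) + A (i - (2 * (q + 1) : ℕ)) i +
        (A i (i + (2 * (q + 1) + 1 : ℕ)) + A (i - (2 * (q + 1) + 1 : ℕ)) i) =
      2 * A i (i + (2 * (q + 1) : ℕ)) := by
    rw [hanti (2 * (q + 1)) (by omega) (by omega),
      hanti (2 * (q + 1) + 1) (by omega) (by omega), pow_succ, pow_mul]
    norm_num
    ring
  have hfirst : A i (i + (2 * 0 : ℕ)) + A (i - (2 * 0 : ℕ)) i +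
      (A i (i + (2 * 0 + 1 : ℕ)) + A (i - (2 * 0 + 1 : ℕ)) i) = 0 := by
    have h := (h1 (i - 1)).2.2.2
    rw [sub_add_cancel] at h
    simp [h, (h1 i).2.1, (h1 i).2.2.2]
  have hlast : A i (i + (2 * (r + 1 + 1) : ℕ)) + A (i - (2 * (r + 1 + 1) : ℕ)) i +
      (A i (i + (2 * (r + 1 + 1) + 1 : ℕ)) + A (i - (2 * (r + 1 + 1) + 1 : ℕ)) i) = 0 := by
    have e1 : i + (2 * (r + 1 + 1) : ℕ) = i - 2 := by
      push_cast; linear_combination hcast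
    have e2 : i - (2 * (r + 1 + 1) : ℕ) = i + 2 := by
      push_cast; linear_combination -hcast
    have e3 : i + (2 * (r + 1 + 1) + 1 : ℕ) = i - 1 := by
      push_cast; linear_combination hcast
    have e4 : i - (2 * (r + 1 + 1) + 1 : ℕ) = i + 1 := by
      push_cast; linear_combination -hcast
    have h := (h1 (i + 2)).2.2.1
    have h' := (h1 (i + 1)).1
    rw [add_sub_cancel_right] at h h'
    rw [e1, e2, e3, e4, h, h', (h1 i).1, (h1 i).2.2.1]
    norm_num
  have htwo : A i (i + (2 * (0 + 1) : ℕ)) = -1 := by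
    have h := h2 (i - 1) 2 le_rfl (by omega)
    rw [sub_add_cancel, show i - 1 + ((2 : ℕ) : ZMod (2 * (r + 3))) = i + 1 by push_cast; ring,
      hi, add_assoc] at h
    rw [← h]
    congr 1
  have heven : ∑ q ∈ Finset.range r, A i (i + (2 * (q + 1 + 1) : ℕ)) = 1 := by
    rw [Finset.sum_range_two_mul, Finset.sum_range_succ, hlast, Finset.sum_range_succ', hfirst,
      Finset.sum_congr rfl fun q hq => hmid q (Finset.mem_range.mp hq), ← Finset.mul_sum,
      Finset.sum_range_succ', htwo] at hsum
    linarith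
  have hpos : ∑ _q ∈ Finset.range r, (0 : ℤ) < ∑ q ∈ Finset.range r,
      (A i (i + (2 * (q + 1 + 1) : ℕ)) + A i (i + (2 * (r - 1 - q + 1 + 1) : ℕ))) := by
    rw [Finset.sum_add_distrib,
      Finset.sum_range_reflect (fun q => A i (i + (2 * (q + 1 + 1) : ℕ))), heven]
    simp
  obtain ⟨q, hq, hlt⟩ := Finset.exists_lt_of_sum_lt hpos
  rw [Finset.mem_range] at hq
  refine ⟨i, 2 * (q + 1 + 1), by omega, by omega, hi, ?_, ?_⟩
  · rcases hpm i (i + (2 * (q + 1 + 1) : ℕ)) with h | h <;>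
      rcases hpm i (i + (2 * (r - 1 - q + 1 + 1) : ℕ)) with h' | h' <;> omega
  · have h := hanti (2 * (r - 1 - q + 1 + 1)) (by omega) (by omega)
    have e : i - (2 * (r - 1 - q + 1 + 1) : ℕ) = i + (2 * (q + 1 + 1) : ℕ) := by
      have hn : ((2 * (r - 1 - q + 1 + 1) + 2 * (q + 1 + 1) : ℕ) : ZMod (2 * (r + 3))) = 0 := by
        rw [show 2 * (r - 1 - q + 1 + 1) + 2 * (q + 1 + 1) = 2 * (r + 3) by omega,
          ZMod.natCast_self]
      rw [Nat.cast_add] at hn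
      linear_combination -hn
    rw [e, pow_mul, neg_one_sq, one_pow, one_mul] at h
    rw [h]
    rcases hpm i (i + (2 * (q + 1 + 1) : ℕ)) with h | h <;>
      rcases hpm i (i + (2 * (r - 1 - q + 1 + 1) : ℕ)) with h' | h' <;> omega
end
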